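/- arXiv:2505.12338 — 5 statements merged into one kernel-verified Lean document; each statement's English description precedes it below -/
import Mathlib

section
/- For all integers j ≥ 1 and k ≥ 1, the number of connected non-flat partitions of the grid [j]×[k] satisfies |CNF(j,k)| ≤ (j!)^k (k!)^{j−1}. -/
open Finset

/-- A partition of the grid `[j]×[k]` is *non-flat* if every block contains at most one
element of each row. -/
def NonFlat {j k : ℕ} (ρ : Finpartition (Finset.univ : Finset (Fin j × Fin k))) : Prop :=
  ∀ b ∈ ρ.parts, ∀ x ∈ b, ∀ y ∈ b, Prod.fst x = Prod.fst y → x = y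

/-- A partition of the grid `[j]×[k]` is *connected* if the rows cannot be split into two
nonempty groups such that no block contains elements from both groups. -/
def ConnP {j k : ℕ} (ρ : Finpartition (Finset.univ : Finset (Fin j × Fin k))) : Prop :=
  ∀ A : Finset (Fin j), A.Nonempty → A ≠ Finset.univ →
    ∃ b ∈ ρ.parts, (∃ x ∈ b, Prod.fst x ∈ A) ∧ (∃ y ∈ b, Prod.fst y ∉ A)

open scoped Nat in
/-- A positive real `τ` at which `(1 + τ) ^ m` is dominated both by `(m + 1)!` and by
`2 τ ^ (m + 1)`. -/
lemma exists_one_add_pow_le_factorial (m : ℕ) :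
    ∃ τ : ℝ, 0 < τ ∧ (1 + τ) ^ m ≤ (m + 1)! ∧ (1 + τ) ^ m ≤ 2 * τ ^ (m + 1) := by
  rcases lt_or_ge m 31 with hm | hm
  · rcases lt_or_ge m 3 with h3 | h3
    · interval_cases m
      · exact ⟨1, by norm_num, by norm_num [Nat.factorial], by norm_num⟩
      · exact ⟨1, by norm_num, by norm_num [Nat.factorial], by norm_num⟩
      · exact ⟨36 / 25, by norm_num, by norm_num [Nat.factorial], by norm_num⟩
    · refine ⟨(18 * m + 39) / 50, by positivity, ?_, ?_⟩ <;>
      · interval_cases m <;> norm_num [Nat.factorial]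
  · have hm' : (31 : ℝ) ≤ m := by exact_mod_cast hm
    refine ⟨m / 3, by positivity, ?_, ?_⟩
    · clear hm'
      induction m, hm using Nat.le_induction with
      | base => norm_num [Nat.factorial]
      | succ m hm ih =>
        have hm' : (31 : ℝ) ≤ m := by exact_mod_cast hm
        have h1 : (1 + 1 / ((m : ℝ) + 3)) ^ m ≤ 2.7183 := by
          calc (1 + 1 / ((m : ℝ) + 3)) ^ m ≤ (Real.exp (1 / ((m : ℝ) + 3))) ^ m := by
                gcongr
                linarith [Real.add_one_le_exp (1 / ((m : ℝ) + 3))]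
            _ = Real.exp (m * (1 / ((m : ℝ) + 3))) := by rw [← Real.exp_nat_mul]
            _ ≤ Real.exp 1 := by
                gcongr
                rw [mul_one_div, div_le_one (by positivity)]
                linarith
            _ ≤ 2.7183 := by linarith [Real.exp_one_lt_d9]
        have h2 : (1 + ((m + 1 : ℕ) : ℝ) / 3) = (1 + (m : ℝ) / 3) * (1 + 1 / ((m : ℝ) + 3)) := by
          push_cast
          field_simp
          ring
        rw [pow_succ]
        nth_rewrite 1 [h2]
        rw [mul_pow, Nat.factorial_succ]
        push_cast
        calc (1 + (m : ℝ) / 3) ^ m * (1 + 1 / ((m : ℝ) + 3)) ^ m * (1 + ((m : ℝ) + 1) / 3)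
            ≤ ((m + 1)! : ℝ) * 2.7183 * (1 + ((m : ℝ) + 1) / 3) := by gcongr
          _ = (2.7183 * (1 + ((m : ℝ) + 1) / 3)) * (m + 1)! := by ring
          _ ≤ ((m : ℝ) + 1 + 1) * (m + 1)! := by
              gcongr
              linarith
    · have h1 : (1 + 3 / (m : ℝ)) ^ m ≤ 2 * (m / 3) := by
        calc (1 + 3 / (m : ℝ)) ^ m ≤ (Real.exp (3 / (m : ℝ))) ^ m := by
              gcongr
              linarith [Real.add_one_le_exp (3 / (m : ℝ))]
          _ = (Real.exp 1) ^ 3 := by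
              rw [← Real.exp_nat_mul, ← Real.exp_nat_mul]
              congr 1
              field_simp
              norm_num
          _ ≤ 2.7183 ^ 3 := by
              gcongr
              linarith [Real.exp_one_lt_d9]
          _ ≤ 2 * (m / 3) := by
              norm_num
              linarith
      have h2 : 1 + (m : ℝ) / 3 = (m / 3) * (1 + 3 / (m : ℝ)) := by
        field_simp
        ring
      rw [h2, mul_pow, pow_succ]
      calc ((m : ℝ) / 3) ^ m * (1 + 3 / (m : ℝ)) ^ m ≤ ((m : ℝ) / 3) ^ m * (2 * (m / 3)) := by
            gcongr
        _ = _ := by ring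

lemma succ_mul_pow_le (m : ℕ) {s : ℝ} (hs : 0 ≤ s) : (m + 1) * s ^ m ≤ m * s ^ (m + 1) + 1 := by
  induction m with
  | zero => simp
  | succ m ih =>
    have h := mul_le_mul_of_nonneg_right ih hs
    have hb : 1 + ((m + 1 : ℕ) : ℝ) * (s - 1) ≤ (1 + (s - 1)) ^ (m + 1) :=
      one_add_mul_le_pow (by linarith) _
    push_cast at hb ⊢
    rw [add_sub_cancel] at hb
    have h2 : 0 ≤ ((m : ℝ) + 1) * s ^ m * (s - 1) ^ 2 := by positivity
    simp only [pow_succ] at *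
    nlinarith

open scoped Nat in
lemma exists_one_add_pow_le_convex_comb (m : ℕ) :
    ∃ c : ℝ, 0 ≤ c ∧ c < 1 ∧ ∀ t : ℝ, 0 ≤ t →
      (1 + t) ^ m ≤ c * (2 * t ^ (m + 1)) + (1 - c) * (m + 1)! := by
  obtain ⟨τ, hτ, h1, h2⟩ := exists_one_add_pow_le_factorial m
  set θ : ℝ := τ / (1 + τ) with hθ
  have hθ0 : 0 ≤ θ := by positivity
  have hθ1 : θ < 1 := by rw [hθ, div_lt_one (by positivity)]; linarith
  have hm0 : (0 : ℝ) ≤ m / (m + 1) := by positivity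
  have hm1 : (m : ℝ) / (m + 1) ≤ 1 := by rw [div_le_one (by positivity)]; linarith
  have hc1 : θ * (m / (m + 1)) < 1 :=
    lt_of_le_of_lt (mul_le_of_le_one_right hθ0 hm1) hθ1
  refine ⟨θ * (m / (m + 1)), by positivity, hc1, fun t ht => ?_⟩
  set s : ℝ := t / τ with hs
  have hs0 : 0 ≤ s := by positivity
  have hts : t = τ * s := by rw [hs]; field_simp
  have e1 : 1 + t = (1 + τ) * ((1 - θ) * 1 + θ * s) := by
    rw [hts, hθ]
    field_simp
    ring
  have e2 : ((1 - θ) * 1 + θ * s) ^ m ≤ (1 - θ) * 1 ^ m + θ * s ^ m :=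
    (convexOn_pow m).2 (Set.mem_Ici.2 zero_le_one) (Set.mem_Ici.2 hs0)
      (by linarith) hθ0 (by ring)
  have e3 := succ_mul_pow_le m hs0
  have e4 : s ^ m ≤ m / (m + 1) * s ^ (m + 1) + 1 - m / (m + 1) := by
    have : (m : ℝ) / (m + 1) * s ^ (m + 1) + 1 - m / (m + 1)
        = (m * s ^ (m + 1) + 1) / (m + 1) := by
      field_simp
      ring
    rw [this, le_div_iff₀ (by positivity)]
    linarith
  have e5 : ((1 - θ) * 1 + θ * s) ^ m
      ≤ θ * (m / (m + 1)) * s ^ (m + 1) + (1 - θ * (m / (m + 1))) := by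
    have := mul_le_mul_of_nonneg_left e4 hθ0
    rw [one_pow] at e2
    linarith
  calc (1 + t) ^ m = (1 + τ) ^ m * ((1 - θ) * 1 + θ * s) ^ m := by rw [e1, mul_pow]
    _ ≤ (1 + τ) ^ m * (θ * (m / (m + 1)) * s ^ (m + 1) + (1 - θ * (m / (m + 1)))) := by
        gcongr
    _ = θ * (m / (m + 1)) * ((1 + τ) ^ m * s ^ (m + 1))
        + (1 - θ * (m / (m + 1))) * (1 + τ) ^ m := by ring
    _ ≤ θ * (m / (m + 1)) * (2 * τ ^ (m + 1) * s ^ (m + 1))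
        + (1 - θ * (m / (m + 1))) * (m + 1)! := by
        have : 0 ≤ 1 - θ * (m / (m + 1)) := by linarith
        gcongr
    _ = _ := by rw [hts, mul_pow]; ring

/-- `e` times the expectation of `C(N + k, k) ^ m` for `N` Poisson of parameter one. -/
noncomputable def chooseMoment (m k : ℕ) : ℝ :=
  ∑' n : ℕ, ((n + k).choose k : ℝ) ^ m / n.factorial

lemma summable_choose_pow_mul_pow_div_factorial (m k l : ℕ) :
    Summable fun n : ℕ => ((n + k).choose k : ℝ) ^ m * (n : ℝ) ^ l / n.factorial := by
  refine Summable.of_nonneg_of_le (fun n => by positivity) (fun n => ?_)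
    ((Real.summable_pow_div_factorial (2 ^ (m + l))).mul_left (2 ^ (k * m)))
  have h1 : ((n + k).choose k : ℝ) ≤ 2 ^ (n + k) := by
    exact_mod_cast Nat.choose_le_two_pow (n + k) k
  have h2 : (n : ℝ) ≤ 2 ^ n := by
    exact_mod_cast Nat.lt_two_pow_self.le
  calc ((n + k).choose k : ℝ) ^ m * (n : ℝ) ^ l / n.factorial
      ≤ (2 ^ (n + k)) ^ m * (2 ^ n) ^ l / n.factorial := by gcongr
    _ = _ := by
      rw [← mul_div_assoc]
      congr 1
      simp only [← pow_mul, ← pow_add]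
      congr 1
      ring

lemma summable_choose_pow_div_factorial (m k : ℕ) :
    Summable fun n : ℕ => ((n + k).choose k : ℝ) ^ m / n.factorial := by
  simpa using summable_choose_pow_mul_pow_div_factorial m k 0

lemma summable_choose_pow_div_factorial_mul_pow (m k : ℕ) :
    Summable fun n : ℕ => ((n + k).choose k : ℝ) ^ m / n.factorial *
      ((k + 1) * ((n : ℝ) / (k + 1)) ^ (m + 1)) := by
  refine ((summable_choose_pow_mul_pow_div_factorial m k (m + 1)).mul_right
    ((k + 1) / ((k : ℝ) + 1) ^ (m + 1))).congr fun n => ?_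
  rw [div_pow]
  ring

lemma chooseMoment_zero_right (m : ℕ) : chooseMoment m 0 = Real.exp 1 := by
  rw [Real.exp_eq_exp_ℝ, NormedSpace.exp_eq_tsum_div]
  simp [chooseMoment]

lemma cast_choose_succ_eq (n k : ℕ) :
    ((n + (k + 1)).choose (k + 1) : ℝ) = (n + k).choose k * (1 + n / (k + 1)) := by
  have h : ((n + k + 1 : ℕ) : ℝ) * (n + k).choose k
      = (n + k + 1).choose (k + 1) * (k + 1 : ℕ) := by
    exact_mod_cast Nat.add_one_mul_choose_eq (n + k) k
  push_cast at h
  rw [← add_assoc]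
  field_simp
  linarith

lemma cast_choose_succ_eq_shift (n k : ℕ) :
    ((n + (k + 1)).choose (k + 1) : ℝ)
      = (n + 1 + k).choose k * ((n + 1 : ℕ) / (k + 1)) := by
  have h : ((n + k + 1).choose (k + 1) : ℝ) * (k + 1 : ℕ)
      = (n + k + 1).choose k * (n + 1 : ℕ) := by
    have := Nat.choose_succ_right_eq (n + k + 1) k
    rw [show n + k + 1 - k = n + 1 by omega] at this
    exact_mod_cast this
  push_cast at h ⊢
  rw [← add_assoc, show n + 1 + k = n + k + 1 by ring]
  field_simp
  linarith

lemma chooseMoment_succ_eq (m k : ℕ) :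
    chooseMoment m (k + 1) = ∑' n : ℕ, ((n + k).choose k : ℝ) ^ m / n.factorial *
      ((k + 1) * ((n : ℝ) / (k + 1)) ^ (m + 1)) := by
  symm
  rw [Summable.tsum_eq_zero_add]
  · simp only [CharP.cast_eq_zero, zero_div, ne_eq, Nat.add_eq_zero_iff, one_ne_zero, and_false,
      not_false_eq_true, zero_pow, mul_zero, zero_add, chooseMoment]
    refine tsum_congr fun n => ?_
    rw [cast_choose_succ_eq_shift, mul_pow, Nat.factorial_succ]
    push_cast
    field_simp
    rw [pow_succ]
    field_simp
  · exact summable_choose_pow_div_factorial_mul_pow m k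

lemma chooseMoment_succ_eq_tsum_one_add (m k : ℕ) :
    chooseMoment m (k + 1) = ∑' n : ℕ, ((n + k).choose k : ℝ) ^ m / n.factorial *
      (1 + (n : ℝ) / (k + 1)) ^ m := by
  refine tsum_congr fun n => ?_
  rw [cast_choose_succ_eq, mul_pow]
  ring

lemma chooseMoment_succ_le (m k : ℕ) (hk : 1 ≤ k) :
    chooseMoment m (k + 1) ≤ (m + 1).factorial * chooseMoment m k := by
  obtain ⟨c, hc0, hc1, hc⟩ := exists_one_add_pow_le_convex_comb m
  have hk' : (1 : ℝ) ≤ k := by exact_mod_cast hk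
  have s1 := summable_choose_pow_div_factorial_mul_pow m k
  have s2 : Summable fun n : ℕ => ((n + k).choose k : ℝ) ^ m / n.factorial *
      (1 + (n : ℝ) / (k + 1)) ^ m := by
    refine (summable_choose_pow_div_factorial m (k + 1)).congr fun n => ?_
    rw [cast_choose_succ_eq, mul_pow]
    ring
  have s3 := summable_choose_pow_div_factorial m k
  have h : chooseMoment m (k + 1) ≤ c * chooseMoment m (k + 1)
      + ((1 - c) * (m + 1).factorial) * chooseMoment m k := by
    nth_rewrite 1 [chooseMoment_succ_eq_tsum_one_add]
    rw [chooseMoment_succ_eq, chooseMoment, ← tsum_mul_left, ← tsum_mul_left,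
      ← (s1.mul_left c).tsum_add (s3.mul_left _)]
    refine s2.tsum_le_tsum (fun n => ?_) ((s1.mul_left c).add (s3.mul_left _))
    have ht : (0 : ℝ) ≤ n / (k + 1) := by positivity
    calc ((n + k).choose k : ℝ) ^ m / n.factorial * (1 + (n : ℝ) / (k + 1)) ^ m
        ≤ ((n + k).choose k : ℝ) ^ m / n.factorial *
          (c * ((k + 1) * ((n : ℝ) / (k + 1)) ^ (m + 1)) + (1 - c) * (m + 1).factorial) := by
          gcongr
          refine (hc _ ht).trans ?_
          gcongr
          linarith
      _ = _ := by ring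
  have : (1 - c) * chooseMoment m (k + 1)
      ≤ (1 - c) * ((m + 1).factorial * chooseMoment m k) := by linarith
  exact le_of_mul_le_mul_left this (by linarith)

/-- The Bell numbers, in Dobinski's form, are at most the factorials. -/
lemma tsum_pow_div_factorial_le (m : ℕ) :
    ∑' n : ℕ, (n : ℝ) ^ m / n.factorial ≤ m.factorial * Real.exp 1 := by
  induction m using Nat.strong_induction_on with
  | _ m ih =>
    rcases m with _ | m
    · rw [← chooseMoment_zero_right 0]
      simp [chooseMoment]
    · have hs : ∀ l : ℕ, Summable fun n : ℕ => (n : ℝ) ^ l / n.factorial := fun l => by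
        simpa using summable_choose_pow_mul_pow_div_factorial 0 0 l
      have hshift : ∑' n : ℕ, (n : ℝ) ^ (m + 1) / n.factorial
          = ∑' n : ℕ, ∑ i ∈ range (m + 1), (m.choose i : ℝ) * ((n : ℝ) ^ i / n.factorial) := by
        rw [(hs (m + 1)).tsum_eq_zero_add]
        simp only [CharP.cast_eq_zero, ne_eq, Nat.add_eq_zero_iff, one_ne_zero, and_false,
          not_false_eq_true, zero_pow, zero_div, zero_add]
        refine tsum_congr fun n => ?_
        have : ((n + 1 : ℕ) : ℝ) ^ (m + 1) / (n + 1).factorial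
            = ((n : ℝ) + 1) ^ m / n.factorial := by
          rw [Nat.factorial_succ]
          push_cast
          rw [pow_succ]
          field_simp
        rw [this, add_pow, Finset.sum_div]
        refine Finset.sum_congr rfl fun i _ => ?_
        rw [one_pow]
        ring
      rw [hshift, Summable.tsum_finsetSum fun i _ => (hs i).mul_left _]
      calc ∑ i ∈ range (m + 1), ∑' n : ℕ, (m.choose i : ℝ) * ((n : ℝ) ^ i / n.factorial)
          ≤ ∑ i ∈ range (m + 1), m.factorial * Real.exp 1 := by
            refine Finset.sum_le_sum fun i hi => ?_
            rw [tsum_mul_left]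
            have him : i ≤ m := by simpa [Nat.lt_succ_iff] using hi
            have hfac : (m.choose i : ℝ) * i.factorial ≤ m.factorial := by
              rw [← Nat.choose_mul_factorial_mul_factorial him]
              exact_mod_cast Nat.le_mul_of_pos_right _ (Nat.factorial_pos _)
            calc (m.choose i : ℝ) * ∑' n : ℕ, (n : ℝ) ^ i / n.factorial
                ≤ m.choose i * (i.factorial * Real.exp 1) := by
                  gcongr
                  exact ih i (by omega)
              _ = m.choose i * i.factorial * Real.exp 1 := by ring
              _ ≤ m.factorial * Real.exp 1 := by gcongr
        _ = (m + 1).factorial * Real.exp 1 := by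
            rw [Finset.sum_const, card_range, nsmul_eq_mul, Nat.factorial_succ]
            push_cast
            ring

lemma chooseMoment_le (m k : ℕ) :
    chooseMoment m k ≤ ((m + 1).factorial : ℝ) ^ k * Real.exp 1 := by
  induction k with
  | zero => simp [chooseMoment_zero_right]
  | succ k ih =>
    rcases Nat.eq_zero_or_pos k with rfl | hk
    · rw [chooseMoment_succ_eq]
      simpa [div_eq_mul_inv, mul_comm] using tsum_pow_div_factorial_le (m + 1)
    · calc chooseMoment m (k + 1) ≤ (m + 1).factorial * chooseMoment m k :=
            chooseMoment_succ_le m k hk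
        _ ≤ (m + 1).factorial * (((m + 1).factorial : ℝ) ^ k * Real.exp 1) := by gcongr
        _ = _ := by ring

lemma hasSum_descFactorial_div_factorial (b : ℕ) :
    HasSum (fun n : ℕ => (n.descFactorial b : ℝ) / n.factorial) (Real.exp 1) := by
  rw [← hasSum_nat_add_iff' b]
  have h0 : ∑ i ∈ range b, (i.descFactorial b : ℝ) / i.factorial = 0 :=
    Finset.sum_eq_zero fun i hi => by
      rw [Nat.descFactorial_of_lt (by simpa using hi)]
      simp
  rw [h0, sub_zero]
  have h := NormedSpace.expSeries_div_hasSum_exp (𝔸 := ℝ) 1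
  rw [← Real.exp_eq_exp_ℝ] at h
  refine h.congr_fun fun n => ?_
  rw [one_pow, ← Nat.factorial_mul_descFactorial (Nat.le_add_left b n), Nat.add_sub_cancel]
  have : ((n + b).descFactorial b : ℝ) ≠ 0 := by
    exact_mod_cast (Nat.descFactorial_pos.2 (Nat.le_add_left b n)).ne'
  push_cast
  field_simp

lemma hasSum_descFactorial_pow_div_factorial (m k : ℕ) :
    HasSum (fun n : ℕ => (n.descFactorial k : ℝ) ^ (m + 1) / n.factorial)
      ((k.factorial : ℝ) ^ m * chooseMoment m k) := by
  rw [← hasSum_nat_add_iff' k]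
  have h0 : ∑ i ∈ range k, (i.descFactorial k : ℝ) ^ (m + 1) / i.factorial = 0 :=
    Finset.sum_eq_zero fun i hi => by
      rw [Nat.descFactorial_of_lt (by simpa using hi)]
      simp
  rw [h0, sub_zero]
  refine HasSum.congr_fun
    ((summable_choose_pow_div_factorial m k).hasSum.mul_left ((k.factorial : ℝ) ^ m)) fun n => ?_
  rw [← Nat.factorial_mul_descFactorial (Nat.le_add_left k n), Nat.add_sub_cancel, pow_succ,
    ← mul_div_assoc, ← mul_pow]
  have : ((n + k).descFactorial k : ℝ) ≠ 0 := by
    exact_mod_cast (Nat.descFactorial_pos.2 (Nat.le_add_left k n)).ne'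
  have h1 : (k.factorial : ℝ) * (n + k).choose k = (n + k).descFactorial k := by
    exact_mod_cast (Nat.descFactorial_eq_factorial_mul_choose (n + k) k).symm
  rw [h1]
  push_cast
  field_simp

/-- The row-wise injective labelling of the grid obtained by labelling the blocks of a non-flat
partition with distinct labels. -/
def NonFlat.labelling {j k n : ℕ} {ρ : Finpartition (Finset.univ : Finset (Fin j × Fin k))}
    (hρ : NonFlat ρ) (φ : ρ.parts ↪ Fin n) (i : Fin j) : Fin k ↪ Fin n where
  toFun l := φ ⟨ρ.part (i, l), ρ.part_mem.2 (mem_univ _)⟩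
  inj' l l' h := by
    have h1 : ρ.part (i, l) = ρ.part (i, l') := congrArg Subtype.val (φ.injective h)
    have h2 := hρ _ (ρ.part_mem.2 (mem_univ (i, l'))) (i, l)
      (h1 ▸ ρ.mem_part (mem_univ _)) (i, l') (ρ.mem_part (mem_univ _)) rfl
    exact congrArg Prod.snd h2

lemma Finpartition.ext_of_part_eq_imp {α : Type*} [DecidableEq α] {s : Finset α}
    {ρ ρ' : Finpartition s}
    (h : ∀ x ∈ s, ∀ y ∈ s, ρ.part x = ρ.part y ↔ ρ'.part x = ρ'.part y) : ρ = ρ' := by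
  have hpart : ∀ x ∈ s, ρ.part x = ρ'.part x := fun x hx => by
    ext y
    constructor
    · intro hy
      have hys := ρ.part_subset x hy
      rw [ρ.mem_part_iff_part_eq_part hys hx] at hy
      rw [ρ'.mem_part_iff_part_eq_part hys hx]
      exact (h _ hys _ hx).1 hy
    · intro hy
      have hys := ρ'.part_subset x hy
      rw [ρ'.mem_part_iff_part_eq_part hys hx] at hy
      rw [ρ.mem_part_iff_part_eq_part hys hx]
      exact (h _ hys _ hx).2 hy
  ext b
  constructor
  · intro hb
    obtain ⟨x, hx⟩ := ρ.nonempty_of_mem_parts hb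
    have hxs := ρ.le hb hx
    rw [← ρ.part_eq_of_mem hb hx, hpart x hxs]
    exact ρ'.part_mem.2 hxs
  · intro hb
    obtain ⟨x, hx⟩ := ρ'.nonempty_of_mem_parts hb
    have hxs := ρ'.le hb hx
    rw [← ρ'.part_eq_of_mem hb hx, ← hpart x hxs]
    exact ρ.part_mem.2 hxs

lemma NonFlat.labelling_injective (j k n : ℕ) :
    Function.Injective fun p : Σ ρ : {ρ : Finpartition (Finset.univ : Finset (Fin j × Fin k)) //
      NonFlat ρ}, (ρ.1.parts ↪ Fin n) => p.1.2.labelling p.2 := by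
  rintro ⟨⟨ρ, hρ⟩, φ⟩ ⟨⟨ρ', hρ'⟩, φ'⟩ h
  have h1 : ∀ x : Fin j × Fin k, φ ⟨ρ.part x, ρ.part_mem.2 (mem_univ _)⟩
      = φ' ⟨ρ'.part x, ρ'.part_mem.2 (mem_univ _)⟩ := fun x =>
    DFunLike.congr_fun (congrFun h x.1) x.2
  have h2 : ρ = ρ' := Finpartition.ext_of_part_eq_imp fun x _ y _ => by
    have e1 : ρ.part x = ρ.part y ↔ φ ⟨ρ.part x, ρ.part_mem.2 (mem_univ _)⟩
        = φ ⟨ρ.part y, ρ.part_mem.2 (mem_univ _)⟩ := by simp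
    have e2 : ρ'.part x = ρ'.part y ↔ φ' ⟨ρ'.part x, ρ'.part_mem.2 (mem_univ _)⟩
        = φ' ⟨ρ'.part y, ρ'.part_mem.2 (mem_univ _)⟩ := by simp
    rw [e1, e2, h1, h1]
  subst h2
  have h3 : φ = φ' := by
    ext ⟨b, hb⟩
    obtain ⟨x, hx⟩ := ρ.nonempty_of_mem_parts hb
    have := h1 x
    simp only [ρ.part_eq_of_mem hb hx] at this
    rw [this]
  rw [h3]

open Classical in
lemma sum_descFactorial_card_parts_le (j k n : ℕ) :
    ∑ ρ : {ρ : Finpartition (Finset.univ : Finset (Fin j × Fin k)) // NonFlat ρ},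
      n.descFactorial #ρ.1.parts ≤ n.descFactorial k ^ j := by
  have h := Fintype.card_le_of_injective _ (NonFlat.labelling_injective j k n)
  simpa [Fintype.card_sigma, Fintype.card_embedding_eq] using h

lemma card_nonFlat_le (m k : ℕ) :
    Nat.card {ρ : Finpartition (Finset.univ : Finset (Fin (m + 1) × Fin k)) // NonFlat ρ}
      ≤ (m + 1).factorial ^ k * k.factorial ^ m := by
  classical
  have hsum := hasSum_sum (s := Finset.univ) fun
    (ρ : {ρ : Finpartition (Finset.univ : Finset (Fin (m + 1) × Fin k)) // NonFlat ρ}) _ =>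
      hasSum_descFactorial_div_factorial #ρ.1.parts
  have hle := hasSum_le (fun n => ?_) hsum (hasSum_descFactorial_pow_div_factorial m k)
  · rw [Finset.sum_const, nsmul_eq_mul, Finset.card_univ, ← Nat.card_eq_fintype_card] at hle
    have h2 : (Nat.card {ρ : Finpartition (Finset.univ : Finset (Fin (m + 1) × Fin k)) //
        NonFlat ρ} : ℝ) * Real.exp 1
        ≤ ((m + 1).factorial ^ k * k.factorial ^ m) * Real.exp 1 := by
      refine hle.trans ?_
      calc (k.factorial : ℝ) ^ m * chooseMoment m k
          ≤ (k.factorial : ℝ) ^ m * (((m + 1).factorial : ℝ) ^ k * Real.exp 1) := by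
            gcongr
            exact chooseMoment_le m k
        _ = _ := by ring
    exact_mod_cast le_of_mul_le_mul_right h2 (Real.exp_pos 1)
  · rw [← Finset.sum_div]
    gcongr
    exact_mod_cast sum_descFactorial_card_parts_le (m + 1) k n

/-- The number of connected non-flat partitions of `[j]×[k]` is at most `j!^k k!^(j-1)`. -/
theorem cnf_card_le (j k : ℕ) (hj : 1 ≤ j) (hk : 1 ≤ k) :
    Nat.card {ρ : Finpartition (Finset.univ : Finset (Fin j × Fin k)) //
        NonFlat ρ ∧ ConnP ρ}
      ≤ j.factorial ^ k * k.factorial ^ (j - 1) := by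
  obtain ⟨m, rfl⟩ : ∃ m, j = m + 1 := ⟨j - 1, by omega⟩
  refine le_trans ?_ (card_nonFlat_le m k)
  exact Nat.card_le_card_of_injective (fun ρ => ⟨ρ.1, ρ.2.1⟩) fun ρ ρ' h =>
    Subtype.ext (congrArg (fun x => x.1) h)
end

section
/- For every integer j ≥ 1, Σ_{l=1}^{j} (l−1)! S(j,l) ≤ j^{j−1}, where S(j,l) denotes the Stirling number of the second kind, i.e. the number of partitions of a set with j elements into l nonempty blocks. -/
open Finset

/-- The Stirling number of the second kind `S(j,l)`: the number of partitions of a set with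
`j` elements into exactly `l` nonempty blocks. -/
noncomputable def stirlingSecond (j l : ℕ) : ℕ :=
  Nat.card {σ : Finpartition (Finset.univ : Finset (Fin j)) // σ.parts.card = l}

namespace Finpartition

variable {α β : Type*} [Fintype α] [DecidableEq α]

/-- The function which is constant on the blocks of `σ`, with the value on each block given by the
injection `e`. -/
def blockMap (σ : Finpartition (univ : Finset α)) (e : σ.parts ↪ β) (x : α) : β :=
  e ⟨σ.part x, σ.part_mem.2 (mem_univ x)⟩

theorem part_eq_filter_blockMap [DecidableEq β] (σ : Finpartition (univ : Finset α))
    (e : σ.parts ↪ β) (x : α) :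
    σ.part x = univ.filter fun y => blockMap σ e y = blockMap σ e x := by
  ext y
  rw [mem_filter_univ, blockMap, blockMap, e.injective.eq_iff, Subtype.mk.injEq,
    σ.mem_part_iff_part_eq_part (mem_univ _) (mem_univ _)]

theorem parts_eq_image_part (σ : Finpartition (univ : Finset α)) :
    σ.parts = univ.image σ.part := by
  ext p
  simp only [mem_image, mem_univ, true_and]
  constructor
  · intro hp
    obtain ⟨x, hx⟩ := σ.nonempty_of_mem_parts hp
    exact ⟨x, σ.part_eq_of_mem hp hx⟩
  · rintro ⟨x, rfl⟩
    exact σ.part_mem.2 (mem_univ x)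

theorem blockMap_injective :
    Function.Injective fun p : Σ σ : Finpartition (univ : Finset α), (σ.parts ↪ β) =>
      blockMap p.1 p.2 := by
  classical
  rintro ⟨σ, e⟩ ⟨τ, e'⟩ h
  have hpart : σ.part = τ.part := by
    funext x
    rw [part_eq_filter_blockMap σ e, part_eq_filter_blockMap τ e']
    exact congrArg (fun f : α → β => univ.filter fun y => f y = f x) h
  obtain rfl : σ = τ := by
    ext1
    rw [parts_eq_image_part, parts_eq_image_part, hpart]
  congr 1
  ext ⟨p, hp⟩
  obtain ⟨x, hx⟩ := σ.nonempty_of_mem_parts hp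
  obtain rfl := σ.part_eq_of_mem hp hx
  exact congrFun h x

theorem sum_descFactorial_card_parts_le [Fintype β] :
    ∑ σ : Finpartition (univ : Finset α), (Fintype.card β).descFactorial σ.parts.card ≤
      Fintype.card β ^ Fintype.card α := by
  classical
  have h := Fintype.card_le_of_injective _ (blockMap_injective (α := α) (β := β))
  simpa [Fintype.card_sigma, Fintype.card_embedding_eq] using h

end Finpartition

theorem sum_descFactorial_mul_stirlingSecond_le (j n : ℕ) (s : Finset ℕ) :
    ∑ l ∈ s, n.descFactorial l * stirlingSecond j l ≤ n ^ j := by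
  calc ∑ l ∈ s, n.descFactorial l * stirlingSecond j l
      = ∑ l ∈ s, ∑ σ : Finpartition (univ : Finset (Fin j)) with σ.parts.card = l,
          n.descFactorial σ.parts.card := by
        refine sum_congr rfl fun l _ => ?_
        rw [sum_congr rfl fun σ hσ => by rw [(mem_filter.1 hσ).2], sum_const, smul_eq_mul,
          mul_comm, stirlingSecond, Nat.card_eq_fintype_card, Fintype.card_subtype]
    _ ≤ ∑ σ : Finpartition (univ : Finset (Fin j)), n.descFactorial σ.parts.card :=
        sum_fiberwise_le_sum_of_sum_fiber_nonneg fun _ _ => Nat.zero_le _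
    _ ≤ n ^ j := by
        simpa using Finpartition.sum_descFactorial_card_parts_le (α := Fin j) (β := Fin n)

/-- For every `j ≥ 1`, `Σ_{l=1}^{j} (l-1)! S(j,l) ≤ j^(j-1)`. -/
theorem sum_factorial_stirling_le (j : ℕ) (hj : 1 ≤ j) :
    ∑ l ∈ Finset.Icc 1 j, (l - 1).factorial * stirlingSecond j l ≤ j ^ (j - 1) := by
  refine Nat.le_of_mul_le_mul_left ?_ hj
  rw [mul_pow_sub_one (by omega), mul_sum]
  refine (sum_le_sum fun l hl => ?_).trans
    (sum_descFactorial_mul_stirlingSecond_le j j (Finset.Icc 1 j))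
  obtain ⟨h1, hlj⟩ := mem_Icc.1 hl
  rw [← mul_assoc]
  refine Nat.mul_le_mul_right _ ?_
  obtain ⟨k, rfl⟩ := Nat.exists_eq_add_of_le' h1
  obtain ⟨m, rfl⟩ := Nat.exists_eq_add_of_le' hj
  rw [Nat.succ_descFactorial_succ, Nat.add_sub_cancel, Nat.descFactorial_eq_factorial_mul_choose]
  exact Nat.mul_le_mul_left _ (Nat.le_mul_of_pos_right _ (Nat.choose_pos (by omega)))
end

section
/- Let Z_1,…,Z_j be random variables on a common probability space with |Z_i| ≤ c almost surely for all i = 1,…,j, where c ≥ 0. Then the joint cumulant satisfies |κ(Z_1,…,Z_j)| ≤ c^j j^{j−1}. -/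
open MeasureTheory Finset

/-- The joint cumulant of `Z 0, …, Z (j-1)`, defined by the moment–cumulant formula
`κ(Z_1,…,Z_j) = Σ_{σ ∈ Π([j])} (−1)^{|σ|−1} (|σ|−1)! ∏_{b ∈ σ} E[∏_{i ∈ b} Z_i]`. -/
noncomputable def jointCumulant {Ω : Type*} [MeasurableSpace Ω] (P : Measure Ω)
    {j : ℕ} (Z : Fin j → Ω → ℝ) : ℝ :=
  ∑ σ : Finpartition (Finset.univ : Finset (Fin j)),
    (-1 : ℝ) ^ (σ.parts.card - 1) * ((σ.parts.card - 1).factorial : ℝ) *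
      ∏ b ∈ σ.parts, ∫ ω, ∏ i ∈ b, Z i ω ∂P

/-- Labelling the parts of a partition by distinct elements of `β` gives distinct functions. -/
theorem Finpartition.sum_descFactorial_card_parts_le_s6 (α β : Type*) [Fintype α] [DecidableEq α]
    [Fintype β] :
    ∑ σ : Finpartition (Finset.univ : Finset α), (Fintype.card β).descFactorial σ.parts.card ≤
      Fintype.card β ^ Fintype.card α := by
  classical
  let F : (Σ σ : Finpartition (Finset.univ : Finset α), σ.parts ↪ β) → α → β :=
    fun p i => p.2 ⟨p.1.part i, p.1.part_mem.2 (mem_univ i)⟩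
  have key : ∀ p i k, F p i = F p k ↔ i ∈ p.1.part k := by
    intro p i k
    simp only [F, p.2.apply_eq_iff_eq, Subtype.mk.injEq]
    exact (p.1.mem_part_iff_part_eq_part (mem_univ i) (mem_univ k)).symm
  have hF : Function.Injective F := by
    rintro ⟨σ, e⟩ ⟨τ, f⟩ h
    have hpart : ∀ k, σ.part k = τ.part k := fun k => by
      ext i
      rw [← key ⟨σ, e⟩, ← key ⟨τ, f⟩, h]
    have hστ : σ = τ := by
      have hparts (ρ : Finpartition (Finset.univ : Finset α)) (b : Finset α) :
          b ∈ ρ.parts ↔ ∃ k, ρ.part k = b := by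
        constructor
        · intro hb
          obtain ⟨k, hk⟩ := ρ.nonempty_of_mem_parts hb
          exact ⟨k, ρ.part_eq_of_mem hb hk⟩
        · rintro ⟨k, rfl⟩
          exact ρ.part_mem.2 (mem_univ k)
      ext b
      simp [hparts, hpart]
    subst hστ
    congr 1
    ext ⟨b, hb⟩
    obtain ⟨k, hk⟩ := σ.nonempty_of_mem_parts hb
    obtain rfl := σ.part_eq_of_mem hb hk
    exact congrFun h k
  simpa [Fintype.card_sigma, Fintype.card_embedding_eq] using Fintype.card_le_of_injective F hF

theorem Finpartition.sum_factorial_card_parts_sub_one_le (j : ℕ) :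
    ∑ σ : Finpartition (Finset.univ : Finset (Fin j)), (σ.parts.card - 1).factorial ≤
      j ^ (j - 1) := by
  rcases j with _ | n
  · have h (σ : Finpartition (Finset.univ : Finset (Fin 0))) : σ.parts.card = 0 :=
      by simp
    have hsub : Subsingleton (Finpartition (Finset.univ : Finset (Fin 0))) :=
      ⟨fun σ τ => Finpartition.ext (by rw [card_eq_zero.1 (h σ), card_eq_zero.1 (h τ)])⟩
    simpa [h] using Fintype.card_le_one_iff_subsingleton.2 hsub
  · refine Nat.le_of_mul_le_mul_left ?_ n.succ_pos
    calc (n + 1) * ∑ σ : Finpartition (Finset.univ : Finset (Fin (n + 1))),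
            (σ.parts.card - 1).factorial
        ≤ ∑ σ : Finpartition (Finset.univ : Finset (Fin (n + 1))),
            (n + 1).descFactorial σ.parts.card := by
          rw [mul_sum]
          refine sum_le_sum fun σ _ => ?_
          have hpos : 0 < σ.parts.card :=
            card_pos.2 ⟨_, σ.part_mem.2 (mem_univ (0 : Fin (n + 1)))⟩
          have hle : σ.parts.card ≤ n + 1 := by simpa using σ.card_parts_le_card
          obtain ⟨k, hk⟩ := Nat.exists_eq_succ_of_ne_zero hpos.ne'
          rw [hk, Nat.succ_eq_add_one, Nat.succ_descFactorial_succ, Nat.add_sub_cancel,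
            ← Nat.descFactorial_self]
          exact Nat.mul_le_mul_left _ (Nat.descFactorial_le _ (by omega))
      _ ≤ (n + 1) ^ (n + 1) := by
          simpa using
            Finpartition.sum_descFactorial_card_parts_le_s6 (Fin (n + 1)) (Fin (n + 1))
      _ = (n + 1) * (n + 1) ^ (n + 1 - 1) := by
          rw [Nat.add_sub_cancel, pow_succ']

theorem abs_integral_prod_le_pow_card {Ω ι : Type*} [MeasurableSpace Ω] (P : Measure Ω)
    [IsProbabilityMeasure P] (Z : ι → Ω → ℝ) (c : ℝ) (b : Finset ι)
    (hZ : ∀ i ∈ b, ∀ᵐ ω ∂P, |Z i ω| ≤ c) :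
    |∫ ω, ∏ i ∈ b, Z i ω ∂P| ≤ c ^ b.card := by
  have h : ∀ᵐ ω ∂P, ‖∏ i ∈ b, Z i ω‖ ≤ c ^ b.card := by
    filter_upwards [(ae_ball_iff b.countable_toSet).2 hZ] with ω hω
    rw [Real.norm_eq_abs, abs_prod]
    calc ∏ i ∈ b, |Z i ω| ≤ ∏ _i ∈ b, c := prod_le_prod (fun _ _ => abs_nonneg _) hω
      _ = c ^ b.card := prod_const c
  simpa using norm_integral_le_of_norm_le_const h

/-- If `|Z i| ≤ c` almost surely for all `i`, then `|κ(Z_1,…,Z_j)| ≤ c^j j^(j-1)`. -/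
theorem abs_jointCumulant_le {Ω : Type*} [MeasurableSpace Ω] (P : Measure Ω)
    [IsProbabilityMeasure P] {j : ℕ} (Z : Fin j → Ω → ℝ)
    (hZm : ∀ i, Measurable (Z i)) (c : ℝ) (hc : 0 ≤ c)
    (hZ : ∀ i, ∀ᵐ ω ∂P, |Z i ω| ≤ c) :
    |jointCumulant P Z| ≤ c ^ j * (j : ℝ) ^ (j - 1) := by
  rw [jointCumulant]
  have hterm (σ : Finpartition (Finset.univ : Finset (Fin j))) :
      |(-1 : ℝ) ^ (σ.parts.card - 1) * ((σ.parts.card - 1).factorial : ℝ) *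
        ∏ b ∈ σ.parts, ∫ ω, ∏ i ∈ b, Z i ω ∂P| ≤ c ^ j * ((σ.parts.card - 1).factorial : ℝ) := by
    rw [abs_mul, abs_mul, abs_pow, abs_neg, abs_one, one_pow, one_mul, Nat.abs_cast, abs_prod,
      mul_comm]
    refine mul_le_mul_of_nonneg_right ?_ (Nat.cast_nonneg _)
    calc ∏ b ∈ σ.parts, |∫ ω, ∏ i ∈ b, Z i ω ∂P|
        ≤ ∏ b ∈ σ.parts, c ^ b.card :=
          prod_le_prod (fun _ _ => abs_nonneg _)
            fun b _ => abs_integral_prod_le_pow_card P Z c b fun i _ => hZ i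
      _ = c ^ j := by rw [prod_pow_eq_pow_sum, σ.sum_card_parts, card_univ, Fintype.card_fin]
  refine (abs_sum_le_sum_abs _ _).trans ((sum_le_sum fun σ _ => hterm σ).trans ?_)
  rw [← mul_sum]
  refine mul_le_mul_of_nonneg_left ?_ (pow_nonneg hc j)
  exact_mod_cast Finpartition.sum_factorial_card_parts_sub_one_le j
end

section
/- For all integers j ≥ 1 and n ≥ 1, the j-th cumulant of the generalized U-statistic satisfies |κ_j(S_{n,k}(f))| ≤ n^{1+(k−1)j} ‖f‖_∞^j j^{j−1} (j!)^k (k!)^{j−1}. -/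
open MeasureTheory Finset ProbabilityTheory

/-- The `j`-th cumulant `κ_j(W)` of a random variable `W`. -/
noncomputable def cum {Ω : Type*} [MeasurableSpace Ω] (P : Measure Ω)
    (j : ℕ) (W : Ω → ℝ) : ℝ :=
  jointCumulant P (fun _ : Fin j => W)

/-- The generalized U-statistic
`S_{n,k}(f) = Σ_{β injective} f(X_{β(1)},…,X_{β(k)}, Y_{β(1),β(2)},…,Y_{β(k-1),β(k)})`. -/
noncomputable def genU {S M Ω : Type*} {k n : ℕ}
    (f : (Fin k → S) → ({q : Fin k × Fin k // q.1 < q.2} → M) → ℝ)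
    (X : Fin n → Ω → S) (Y : Fin n → Fin n → Ω → M) (ω : Ω) : ℝ :=
  ∑ β ∈ (Finset.univ : Finset (Fin k → Fin n)).filter Function.Injective,
    f (fun i => X (β i) ω) (fun q => Y (β q.1.1) (β q.1.2) ω)

/-- The projection `f_{(ℓ)}(x) = ∫ f(x_1,…,x_{ℓ−1},x,x_{ℓ+1},…,x_k,y) dμ^{⊗(k−1)} dQ^{⊗k(k−1)/2}`
(the unused `ℓ`-th coordinate is also integrated out, which is harmless since `μ` is a
probability measure). -/
noncomputable def fProj {S M : Type*} [MeasurableSpace S] [MeasurableSpace M] {k : ℕ}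
    (f : (Fin k → S) → ({q : Fin k × Fin k // q.1 < q.2} → M) → ℝ)
    (μ : Measure S) (Q : Measure M) (ℓ : Fin k) (x : S) : ℝ :=
  ∫ z : (Fin k → S) × ({q : Fin k × Fin k // q.1 < q.2} → M),
    f (Function.update z.1 ℓ x) z.2
    ∂((Measure.pi fun _ => μ).prod (Measure.pi fun _ => Q))

section Combinatorics

theorem sum_powerset_two_pow_mul_factorial_le {α : Type*} (s : Finset α) :
    ∑ c ∈ s.powerset, (2 : ℝ) ^ c.card * (c.card.factorial : ℝ)
      ≤ 2 * (2 ^ s.card * (s.card.factorial : ℝ)) - 1 := by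
  rw [Finset.sum_powerset_apply_card (fun r => (2 : ℝ) ^ r * (r.factorial : ℝ))]
  induction s.card with
  | zero => simp; norm_num
  | succ N ih =>
    rw [Finset.sum_range_succ']
    have h : ∀ i ∈ Finset.range (N + 1),
        (N + 1).choose (i + 1) • ((2 : ℝ) ^ (i + 1) * ((i + 1).factorial : ℝ))
          = 2 * (N + 1) * (N.choose i • ((2 : ℝ) ^ i * (i.factorial : ℝ))) := by
      intro i _
      have hc : ((N + 1 : ℕ) : ℝ) * (N.choose i : ℝ)
          = ((N + 1).choose (i + 1) : ℝ) * ((i + 1 : ℕ) : ℝ) := by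
        exact_mod_cast Nat.add_one_mul_choose_eq N i
      simp only [nsmul_eq_mul, Nat.factorial_succ, pow_succ]
      push_cast at hc ⊢
      linear_combination (-(2 : ℝ) ^ i * 2 * (i.factorial : ℝ)) * hc
    rw [Finset.sum_congr rfl h, ← Finset.mul_sum]
    have := mul_le_mul_of_nonneg_left ih (by positivity : (0 : ℝ) ≤ 2 * (N + 1))
    simp only [Nat.factorial_succ, pow_succ]
    push_cast
    simp only [nsmul_eq_mul] at this ⊢
    simp only [Nat.choose_zero_right, pow_zero, Nat.factorial_zero, Nat.cast_one, mul_one]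
    have hN : (0 : ℝ) ≤ N := Nat.cast_nonneg N
    linarith

variable {α : Type*} [DecidableEq α]

/-- The families of blocks of the partitions of `b`. -/
def blockFamilies (b : Finset α) : Finset (Finset (Finset α)) :=
  (Finset.univ : Finset (Finpartition b)).image Finpartition.parts

theorem mem_blockFamilies {b : Finset α} {s : Finset (Finset α)} :
    s ∈ blockFamilies b ↔
      (∀ d ∈ s, d ⊆ b) ∧ (∀ x ∈ b, ∃! d, d ∈ s ∧ x ∈ d) ∧ ∅ ∉ s := by
  simp only [blockFamilies, Finset.mem_image, Finset.mem_univ, true_and]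
  constructor
  · rintro ⟨σ, rfl⟩
    exact ⟨fun d hd => σ.subset hd, fun x hx => σ.existsUnique_mem hx, σ.empty_notMem_parts⟩
  · rintro ⟨h1, h2, h3⟩
    exact ⟨Finpartition.ofExistsUnique s h1 h2 h3, rfl⟩

/-- The Möbius weight of a partition with `r` blocks. -/
noncomputable def cumWeight (r : ℕ) : ℝ := (-1 : ℝ) ^ (r - 1) * ((r - 1).factorial : ℝ)

/-- The cumulant associated with a set function of moments. -/
noncomputable def momentCumulant (m : Finset α → ℝ) (b : Finset α) : ℝ :=
  ∑ σ : Finpartition b, cumWeight σ.parts.card * ∏ d ∈ σ.parts, m d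

theorem momentCumulant_eq_sum_blockFamilies (m : Finset α → ℝ) (b : Finset α) :
    momentCumulant m b = ∑ s ∈ blockFamilies b, cumWeight s.card * ∏ d ∈ s, m d := by
  rw [blockFamilies, Finset.sum_image fun σ _ τ _ h => Finpartition.ext h]
  rfl

theorem card_blockFamilies_filter_notMem {b : Finset α} {x : α} (hx : x ∈ b)
    {t : Finset (Finset α)} (ht : t ∈ blockFamilies b) :
    (t.filter (x ∉ ·)).card + 1 = t.card := by
  obtain ⟨d, ⟨hd, hxd⟩, huniq⟩ := (mem_blockFamilies.1 ht).2.1 x hx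
  have h : t.filter (x ∈ ·) = {d} := by
    ext e
    simp only [Finset.mem_filter, Finset.mem_singleton]
    exact ⟨huniq e, by rintro rfl; exact ⟨hd, hxd⟩⟩
  rw [← Finset.card_filter_add_card_filter_not (s := t) (x ∈ ·), h, Finset.card_singleton,
    add_comm]

theorem eq_of_mem_of_mem_blockFamilies {b : Finset α} {t : Finset (Finset α)}
    (ht : t ∈ blockFamilies b) {d e : Finset α} (hd : d ∈ t) (he : e ∈ t) {x : α}
    (hxd : x ∈ d) (hxe : x ∈ e) : d = e :=
  ((mem_blockFamilies.1 ht).2.1 x ((mem_blockFamilies.1 ht).1 d hd hxd)).unique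
    ⟨hd, hxd⟩ ⟨he, hxe⟩

theorem insert_sdiff_mem_blockFamilies {b c : Finset α} (hc : c ⊂ b)
    {s : Finset (Finset α)} (hs : s ∈ blockFamilies c) :
    insert (b \ c) s ∈ blockFamilies b := by
  have hs' := mem_blockFamilies.1 hs
  refine mem_blockFamilies.2 ⟨?_, ?_, ?_⟩
  · intro d hd
    rcases Finset.mem_insert.1 hd with rfl | hd
    · exact Finset.sdiff_subset
    · exact (hs'.1 d hd).trans hc.1
  · intro x hx
    by_cases hxc : x ∈ c
    · obtain ⟨d, ⟨hd, hxd⟩, huniq⟩ := hs'.2.1 x hxc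
      refine ⟨d, ⟨Finset.mem_insert_of_mem hd, hxd⟩, ?_⟩
      rintro e ⟨he, hxe⟩
      rcases Finset.mem_insert.1 he with rfl | he
      · exact absurd hxc (Finset.mem_sdiff.1 hxe).2
      · exact huniq e ⟨he, hxe⟩
    · refine ⟨b \ c, ⟨Finset.mem_insert_self _ _, Finset.mem_sdiff.2 ⟨hx, hxc⟩⟩, ?_⟩
      rintro e ⟨he, hxe⟩
      rcases Finset.mem_insert.1 he with rfl | he
      · rfl
      · exact absurd (hs'.1 e he hxe) hxc
  · intro h
    rcases Finset.mem_insert.1 h with h | h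
    · exact hc.2 (Finset.sdiff_eq_empty_iff_subset.1 h.symm)
    · exact hs'.2.2 h

theorem erase_mem_blockFamilies {b d : Finset α} {t : Finset (Finset α)}
    (ht : t ∈ blockFamilies b) (hd : d ∈ t) : t.erase d ∈ blockFamilies (b \ d) := by
  have ht' := mem_blockFamilies.1 ht
  refine mem_blockFamilies.2 ⟨?_, ?_, ?_⟩
  · intro e he x hx
    obtain ⟨hne, he⟩ := Finset.mem_erase.1 he
    exact Finset.mem_sdiff.2 ⟨ht'.1 e he hx, fun hxd =>
      hne (eq_of_mem_of_mem_blockFamilies ht he hd hx hxd)⟩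
  · intro x hx
    obtain ⟨hxb, hxd⟩ := Finset.mem_sdiff.1 hx
    obtain ⟨e, ⟨he, hxe⟩, huniq⟩ := ht'.2.1 x hxb
    refine ⟨e, ⟨Finset.mem_erase.2 ⟨?_, he⟩, hxe⟩, fun e' he' =>
      huniq e' ⟨Finset.mem_of_mem_erase he'.1, he'.2⟩⟩
    rintro rfl
    exact hxd hxe
  · exact fun h => ht'.2.2 (Finset.mem_of_mem_erase h)

theorem sdiff_notMem_of_mem_blockFamilies {b c : Finset α} {s : Finset (Finset α)}
    (hs : s ∈ blockFamilies c) : b \ c ∉ s := fun hmem => by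
  have h0 : b \ c = ∅ := by
    rw [← Finset.inter_eq_left.2 ((mem_blockFamilies.1 hs).1 _ hmem)]
    exact Finset.sdiff_inter_self c b
  exact (mem_blockFamilies.1 hs).2.2 (h0 ▸ hmem)

theorem mul_cumWeight_add_cumWeight {r : ℕ} :
    (r : ℝ) * cumWeight r + cumWeight (r + 1) = if r = 0 then 1 else 0 := by
  rcases r with _ | r
  · simp [cumWeight]
  · simp only [cumWeight, Nat.add_sub_cancel, Nat.factorial_succ, pow_succ]
    push_cast
    simp
    ring

/-- The recursion `m b = ∑_{x ∈ c ⊆ b} κ c * m (b \ c)`. -/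
theorem sum_momentCumulant_mul {m : Finset α → ℝ} (hm : m ∅ = 1) {b : Finset α} {x : α}
    (hx : x ∈ b) :
    ∑ c ∈ b.powerset.filter (x ∈ ·), momentCumulant m c * m (b \ c) = m b := by
  have hb : b ∈ b.powerset.filter (x ∈ ·) := by simp [hx]
  rw [← Finset.sum_erase_add _ _ hb, Finset.sdiff_self, hm, mul_one]
  have key : ∑ c ∈ (b.powerset.filter (x ∈ ·)).erase b, momentCumulant m c * m (b \ c)
      = ∑ t ∈ blockFamilies b, ∑ d ∈ t.filter (x ∉ ·),
          cumWeight (t.card - 1) * ∏ e ∈ t, m e := by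
    simp_rw [momentCumulant_eq_sum_blockFamilies, Finset.sum_mul, Finset.sum_sigma']
    refine Finset.sum_nbij' (fun p => ⟨insert (b \ p.1) p.2, b \ p.1⟩)
      (fun p => ⟨b \ p.2, p.1.erase p.2⟩) ?_ ?_ ?_ ?_ ?_
    · rintro ⟨c, s⟩ h
      simp only [Finset.mem_sigma, Finset.mem_erase, Finset.mem_filter, Finset.mem_powerset] at h
      obtain ⟨⟨hne, hcb, hxc⟩, hs⟩ := h
      simp only [Finset.mem_sigma, Finset.mem_filter]
      exact ⟨insert_sdiff_mem_blockFamilies (hcb.ssubset_of_ne hne) hs,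
        Finset.mem_insert_self _ _, by simp [hxc]⟩
    · rintro ⟨t, d⟩ h
      simp only [Finset.mem_sigma, Finset.mem_filter] at h
      obtain ⟨ht, hd, hxd⟩ := h
      simp only [Finset.mem_sigma, Finset.mem_erase, Finset.mem_filter, Finset.mem_powerset]
      refine ⟨⟨fun h => ?_, Finset.sdiff_subset, Finset.mem_sdiff.2 ⟨hx, hxd⟩⟩,
        erase_mem_blockFamilies ht hd⟩
      have hdb := (mem_blockFamilies.1 ht).1 d hd
      have : d = ∅ := by
        rw [← Finset.inter_eq_right.2 hdb, ← Finset.disjoint_iff_inter_eq_empty]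
        exact Finset.sdiff_eq_self_iff_disjoint.1 h
      exact (mem_blockFamilies.1 ht).2.2 (this ▸ hd)
    · rintro ⟨c, s⟩ h
      simp only [Finset.mem_sigma, Finset.mem_erase, Finset.mem_filter, Finset.mem_powerset] at h
      obtain ⟨⟨hne, hcb, hxc⟩, hs⟩ := h
      have hns := sdiff_notMem_of_mem_blockFamilies (b := b) hs
      simp [Finset.sdiff_sdiff_eq_self hcb, Finset.erase_insert hns]
    · rintro ⟨t, d⟩ h
      simp only [Finset.mem_sigma, Finset.mem_filter] at h
      obtain ⟨ht, hd, hxd⟩ := h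
      simp [Finset.sdiff_sdiff_eq_self ((mem_blockFamilies.1 ht).1 d hd), Finset.insert_erase hd]
    · rintro ⟨c, s⟩ h
      simp only [Finset.mem_sigma, Finset.mem_erase, Finset.mem_filter, Finset.mem_powerset] at h
      obtain ⟨⟨hne, hcb, hxc⟩, hs⟩ := h
      have hns := sdiff_notMem_of_mem_blockFamilies (b := b) hs
      simp only [Finset.card_insert_of_notMem hns, Finset.prod_insert hns, Nat.add_sub_cancel]
      ring
  rw [key, momentCumulant_eq_sum_blockFamilies, ← Finset.sum_add_distrib]
  have hterm : ∀ t ∈ blockFamilies b,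
      (∑ d ∈ t.filter (x ∉ ·), cumWeight (t.card - 1) * ∏ e ∈ t, m e)
        + cumWeight t.card * ∏ e ∈ t, m e = if t = {b} then m b else 0 := by
    intro t ht
    have hcard := card_blockFamilies_filter_notMem hx ht
    rw [Finset.sum_const, nsmul_eq_mul, ← mul_assoc, ← add_mul, ← hcard, Nat.add_sub_cancel,
      mul_cumWeight_add_cumWeight]
    by_cases htb : t = {b}
    · subst htb
      have : ((({b} : Finset (Finset α)).filter (x ∉ ·)).card) = 0 := by simpa using hcard
      simp [this]
    · rw [if_neg htb, if_neg, zero_mul]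
      intro h0
      apply htb
      rw [h0, zero_add] at hcard
      obtain ⟨d, rfl⟩ := Finset.card_eq_one.1 hcard.symm
      have hdb := (mem_blockFamilies.1 ht).1 d (Finset.mem_singleton_self d)
      congr 1
      refine hdb.antisymm fun y hy => ?_
      obtain ⟨e, ⟨he, hye⟩, -⟩ := (mem_blockFamilies.1 ht).2.1 y hy
      rwa [Finset.mem_singleton.1 he] at hye
  rw [Finset.sum_congr rfl hterm, Finset.sum_ite_eq', if_pos]
  refine mem_blockFamilies.2 ⟨by simp, fun y hy => ⟨b, by simp [hy], by simp⟩, ?_⟩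
  simpa [eq_comm] using Finset.ne_empty_of_mem hx

/-- A cumulant vanishes as soon as the moments factorise along a nontrivial splitting. -/
theorem momentCumulant_eq_zero {m : Finset α → ℝ} (hm : m ∅ = 1) (A : Finset α)
    (hA : ∀ d, m d = m (d ∩ A) * m (d \ A)) (b : Finset α) (h1 : (b ∩ A).Nonempty)
    (h2 : (b \ A).Nonempty) : momentCumulant m b = 0 := by
  induction b using Finset.strongInduction with
  | H b ih =>
    obtain ⟨x, hx⟩ := h1
    obtain ⟨hxb, hxA⟩ := Finset.mem_inter.1 hx
    have hfull := sum_momentCumulant_mul hm hxb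
    have hpart := sum_momentCumulant_mul hm hx
    have hmul : ∑ c ∈ (b ∩ A).powerset.filter (x ∈ ·), momentCumulant m c * m (b \ c) = m b := by
      rw [hA b, ← hpart, Finset.sum_mul]
      refine Finset.sum_congr rfl fun c hc => ?_
      have hc' := Finset.mem_powerset.1 (Finset.mem_filter.1 hc).1
      rw [hA (b \ c), mul_assoc]
      congr 3
      · ext y; simp; tauto
      · ext y
        have := @hc' y
        simp at this ⊢; tauto
    have hb : b ∈ b.powerset.filter (x ∈ ·) \ (b ∩ A).powerset.filter (x ∈ ·) := by
      obtain ⟨y, hy⟩ := h2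
      simp only [Finset.mem_sdiff, Finset.mem_filter, Finset.mem_powerset]
      refine ⟨⟨subset_rfl, hxb⟩, fun h => ?_⟩
      exact (Finset.mem_sdiff.1 hy).2
        (Finset.mem_inter.1 (h.1 (Finset.mem_sdiff.1 hy).1)).2
    have hsub : (b ∩ A).powerset.filter (x ∈ ·) ⊆ b.powerset.filter (x ∈ ·) :=
      Finset.filter_subset_filter _ (Finset.powerset_mono.2 Finset.inter_subset_left)
    rw [← Finset.sum_sdiff hsub, hmul, Finset.sum_eq_single_of_mem b hb] at hfull
    · simpa [hm] using hfull
    · intro c hc hcb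
      simp only [Finset.mem_sdiff, Finset.mem_filter, Finset.mem_powerset] at hc
      obtain ⟨⟨hsb, hxc⟩, hnot⟩ := hc
      rw [ih c (hsb.ssubset_of_ne hcb) ⟨x, Finset.mem_inter.2 ⟨hxc, hxA⟩⟩, zero_mul]
      by_contra hempty
      rw [Finset.not_nonempty_iff_eq_empty, Finset.sdiff_eq_empty_iff_subset] at hempty
      exact hnot ⟨Finset.subset_inter hsb hempty, hxc⟩

theorem abs_momentCumulant_le {m : Finset α → ℝ} (hm : m ∅ = 1) {C : ℝ} (hC : 0 ≤ C)
    (hmC : ∀ d, |m d| ≤ C ^ d.card) (b : Finset α) (hb : b.Nonempty) :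
    |momentCumulant m b| ≤ 2 ^ (b.card - 1) * ((b.card - 1).factorial : ℝ) * C ^ b.card := by
  induction b using Finset.strongInduction with
  | H b ih =>
    obtain ⟨x, hx⟩ := hb
    have hrec := sum_momentCumulant_mul hm hx
    have hb : b ∈ b.powerset.filter (x ∈ ·) := by simp [hx]
    rw [← Finset.sum_erase_add _ _ hb, Finset.sdiff_self, hm, mul_one] at hrec
    have hbound : ∀ c ∈ (b.powerset.filter (x ∈ ·)).erase b,
        |momentCumulant m c * m (b \ c)|
          ≤ 2 ^ (c.card - 1) * ((c.card - 1).factorial : ℝ) * C ^ b.card := by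
      intro c hc
      simp only [Finset.mem_erase, Finset.mem_filter, Finset.mem_powerset] at hc
      obtain ⟨hne, hcb, hxc⟩ := hc
      rw [abs_mul, ← Finset.card_sdiff_add_card_eq_card hcb, add_comm, pow_add, ← mul_assoc]
      exact mul_le_mul (ih c (hcb.ssubset_of_ne hne) ⟨x, hxc⟩) (hmC _) (abs_nonneg _)
        (by positivity)
    have hsum : ∑ c ∈ b.powerset.filter (x ∈ ·), (2 : ℝ) ^ (c.card - 1)
        * ((c.card - 1).factorial : ℝ)
        = ∑ c ∈ (b.erase x).powerset, (2 : ℝ) ^ c.card * (c.card.factorial : ℝ) := by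
      refine Finset.sum_nbij' (fun c => c.erase x) (fun c => insert x c) ?_ ?_ ?_ ?_ ?_
      · intro c hc
        simp only [Finset.mem_filter, Finset.mem_powerset] at hc ⊢
        exact Finset.erase_subset_erase x hc.1
      · intro c hc
        simp only [Finset.mem_filter, Finset.mem_powerset] at hc ⊢
        exact ⟨Finset.insert_subset hx (hc.trans (Finset.erase_subset _ _)),
          Finset.mem_insert_self _ _⟩
      · intro c hc
        exact Finset.insert_erase (Finset.mem_filter.1 hc).2
      · intro c hc
        exact Finset.erase_insert fun h =>
          Finset.notMem_erase x b (Finset.mem_powerset.1 hc h)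
      · intro c hc
        rw [Finset.card_erase_of_mem (Finset.mem_filter.1 hc).2]
    have htot := sum_powerset_two_pow_mul_factorial_le (b.erase x)
    rw [← hsum, ← Finset.sum_erase_add _ _ hb, Finset.card_erase_of_mem hx] at htot
    have hK : momentCumulant m b = m b
        - ∑ c ∈ (b.powerset.filter (x ∈ ·)).erase b, momentCumulant m c * m (b \ c) := by
      linarith
    have hle : |∑ c ∈ (b.powerset.filter (x ∈ ·)).erase b, momentCumulant m c * m (b \ c)|
        ≤ (∑ c ∈ (b.powerset.filter (x ∈ ·)).erase b, (2 : ℝ) ^ (c.card - 1)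
          * ((c.card - 1).factorial : ℝ)) * C ^ b.card := by
      rw [Finset.sum_mul]
      exact (Finset.abs_sum_le_sum_abs _ _).trans (Finset.sum_le_sum hbound)
    rw [hK]
    refine (abs_sub _ _).trans ?_
    have hCb : 0 ≤ C ^ b.card := by positivity
    nlinarith [hmC b, mul_le_mul_of_nonneg_right htot hCb]

end Combinatorics

section Probability

theorem integral_mul_of_dependsOn {ι E : Type*} [Fintype ι] [DecidableEq ι]
    [MeasurableSpace E] (ν : Measure E) [IsProbabilityMeasure ν] {s t : Finset ι}
    (hst : Disjoint s t) {G H : (ι → E) → ℝ} (hG : Measurable G) (hH : Measurable H)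
    (hGs : DependsOn G s) (hHt : DependsOn H t) :
    ∫ z, G z * H z ∂(Measure.pi fun _ => ν)
      = (∫ z, G z ∂(Measure.pi fun _ => ν)) * ∫ z, H z ∂(Measure.pi fun _ => ν) := by
  obtain ⟨e⟩ : Nonempty E := nonempty_of_isProbabilityMeasure ν
  have hext : ∀ (u : Finset ι), Measurable
      (fun (w : u → E) (i : ι) => if h : i ∈ u then w ⟨i, h⟩ else e) := by
    intro u
    refine measurable_pi_lambda _ fun i => ?_
    by_cases h : i ∈ u
    · simpa [h] using measurable_pi_apply _
    · simp [h]
  have hind : iIndepFun (fun (i : ι) (z : ι → E) => z i) (Measure.pi fun _ => ν) :=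
    iIndepFun_pi (X := fun _ x => x) fun _ => aemeasurable_id
  have h := (hind.indepFun_finset s t hst fun i => measurable_pi_apply i).comp
    (hG.comp (hext s)) (hH.comp (hext t))
  have hG' : (G ∘ (fun (w : s → E) (i : ι) => if h : i ∈ s then w ⟨i, h⟩ else e))
      ∘ (fun (z : ι → E) (i : s) => z i) = G := by
    funext z
    refine hGs fun i hi => ?_
    simp [Finset.mem_coe.1 hi]
  have hH' : (H ∘ (fun (w : t → E) (i : ι) => if h : i ∈ t then w ⟨i, h⟩ else e))
      ∘ (fun (z : ι → E) (i : t) => z i) = H := by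
    funext z
    refine hHt fun i hi => ?_
    simp [Finset.mem_coe.1 hi]
  rw [hG', hH'] at h
  exact h.integral_fun_mul_eq_mul_integral hG.aestronglyMeasurable hH.aestronglyMeasurable

theorem integral_prod_mul_of_dependsOn {ι κ S M : Type*} [Fintype ι] [Fintype κ]
    [DecidableEq ι] [DecidableEq κ] [MeasurableSpace S] [MeasurableSpace M]
    (μ : Measure S) [IsProbabilityMeasure μ] (Q : Measure M) [IsProbabilityMeasure Q]
    {s t : Finset ι} (hst : Disjoint s t) {u v : Finset κ} (huv : Disjoint u v)
    {G H : (ι → S) × (κ → M) → ℝ} (hG : Measurable G) (hH : Measurable H)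
    {B : ℝ} (hGB : ∀ z, |G z| ≤ B) (hHB : ∀ z, |H z| ≤ B)
    (hGd : ∀ x x' y y', (∀ i ∈ s, x i = x' i) → (∀ q ∈ u, y q = y' q) → G (x, y) = G (x', y'))
    (hHd : ∀ x x' y y', (∀ i ∈ t, x i = x' i) → (∀ q ∈ v, y q = y' q) → H (x, y) = H (x', y')) :
    ∫ z, G z * H z ∂((Measure.pi fun _ => μ).prod (Measure.pi fun _ => Q))
      = (∫ z, G z ∂((Measure.pi fun _ => μ).prod (Measure.pi fun _ => Q)))
        * ∫ z, H z ∂((Measure.pi fun _ => μ).prod (Measure.pi fun _ => Q)) := by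
  have hGi : Integrable G ((Measure.pi fun _ => μ).prod (Measure.pi fun _ => Q)) :=
    Integrable.of_bound hG.aestronglyMeasurable B (Filter.Eventually.of_forall hGB)
  have hHi : Integrable H ((Measure.pi fun _ => μ).prod (Measure.pi fun _ => Q)) :=
    Integrable.of_bound hH.aestronglyMeasurable B (Filter.Eventually.of_forall hHB)
  have hGH : Integrable (fun z => G z * H z)
      ((Measure.pi fun _ => μ).prod (Measure.pi fun _ => Q)) :=
    hHi.bdd_mul hG.aestronglyMeasurable (Filter.Eventually.of_forall hGB)
  rw [integral_prod _ hGH, integral_prod _ hGi, integral_prod _ hHi]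
  have hinner : ∀ x : ι → S, ∫ y, G (x, y) * H (x, y) ∂(Measure.pi fun _ => Q)
      = (∫ y, G (x, y) ∂(Measure.pi fun _ => Q)) * ∫ y, H (x, y) ∂(Measure.pi fun _ => Q) :=
    fun x => integral_mul_of_dependsOn Q huv (hG.comp measurable_prodMk_left)
      (hH.comp measurable_prodMk_left)
      (fun y y' h => hGd x x y y' (fun _ _ => rfl) fun q hq => h q hq)
      (fun y y' h => hHd x x y y' (fun _ _ => rfl) fun q hq => h q hq)
  simp_rw [hinner]
  refine integral_mul_of_dependsOn μ hst
    hG.stronglyMeasurable.integral_prod_right'.measurable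
    hH.stronglyMeasurable.integral_prod_right'.measurable ?_ ?_
  · intro x x' h
    exact integral_congr_ae (Filter.Eventually.of_forall fun y =>
      hGd x x' y y (fun i hi => h i hi) fun _ _ => rfl)
  · intro x x' h
    exact integral_congr_ae (Filter.Eventually.of_forall fun y =>
      hHd x x' y y (fun i hi => h i hi) fun _ _ => rfl)

variable {Z : Type*} [MeasurableSpace Z]

theorem prod_parts_integral {j : ℕ} (ν : Measure Z) [IsProbabilityMeasure ν]
    (σ : Finpartition (Finset.univ : Finset (Fin j))) (G : Fin j → Z → ℝ) :
    ∏ b ∈ σ.parts, ∫ z, ∏ i ∈ b, G i z ∂ν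
      = ∫ w : σ.parts → Z, ∏ i, G i (w ⟨σ.part i, σ.part_mem.2 (Finset.mem_univ i)⟩)
        ∂(Measure.pi fun _ => ν) := by
  rw [← Finset.prod_coe_sort, ← integral_fintype_prod_eq_prod
    (fun (b : σ.parts) (z : Z) => ∏ i ∈ (b : Finset (Fin j)), G i z)]
  refine integral_congr_ae (Filter.Eventually.of_forall fun w => ?_)
  simp only
  rw [← Finset.prod_fiberwise_of_maps_to (t := (Finset.univ : Finset σ.parts))
    (g := fun i => (⟨σ.part i, σ.part_mem.2 (Finset.mem_univ i)⟩ : σ.parts))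
    fun i _ => Finset.mem_univ _]
  refine Finset.prod_congr rfl fun b _ => ?_
  have hb : Finset.univ.filter (fun i =>
      (⟨σ.part i, σ.part_mem.2 (Finset.mem_univ i)⟩ : σ.parts) = b) = b.1 := by
    ext i
    rw [Finset.mem_filter, Subtype.ext_iff, σ.part_eq_iff_mem b.2]
    simp
  rw [hb]
  refine Finset.prod_congr rfl fun i hi => ?_
  congr 2
  exact Subtype.ext ((σ.part_eq_of_mem b.2 hi).symm)

theorem abs_prod_le {ι : Type*} (d : Finset ι) (a : ι → ℝ) {C : ℝ} (h : ∀ i, |a i| ≤ C) :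
    |∏ i ∈ d, a i| ≤ C ^ d.card := by
  rw [Finset.abs_prod, ← Finset.prod_const]
  exact Finset.prod_le_prod (fun i _ => abs_nonneg _) fun i _ => h i

theorem abs_integral_prod_le {ι : Type*} (ν : Measure Z) [IsProbabilityMeasure ν]
    (d : Finset ι) {G : ι → Z → ℝ} {C : ℝ} (h : ∀ i z, |G i z| ≤ C) :
    |∫ z, ∏ i ∈ d, G i z ∂ν| ≤ C ^ d.card := by
  have := norm_integral_le_of_norm_le_const (μ := ν) (f := fun z => ∏ i ∈ d, G i z)
    (C := C ^ d.card) (Filter.Eventually.of_forall fun z => abs_prod_le d _ fun i => h i z)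
  simpa using this

theorem cum_sum {ι : Type*} {j : ℕ} (ν : Measure Z) [IsProbabilityMeasure ν] (T : Finset ι)
    {F : ι → Z → ℝ} (hF : ∀ β, Measurable (F β)) {C : ℝ} (hC : ∀ β z, |F β z| ≤ C) :
    cum ν j (fun z => ∑ β ∈ T, F β z)
      = ∑ φ ∈ Fintype.piFinset (fun _ : Fin j => T),
          momentCumulant (fun d => ∫ z, ∏ i ∈ d, F (φ i) z ∂ν) Finset.univ := by
  simp only [momentCumulant]
  rw [Finset.sum_comm, cum, jointCumulant]
  refine Finset.sum_congr rfl fun σ _ => ?_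
  rw [← Finset.mul_sum, cumWeight]
  congr 1
  simp_rw [prod_parts_integral, Finset.prod_univ_sum]
  refine integral_finsetSum _ fun φ _ => ?_
  refine Integrable.of_bound (C := C ^ (Finset.univ : Finset (Fin j)).card)
    (Measurable.aestronglyMeasurable ?_)
    (Filter.Eventually.of_forall fun w => abs_prod_le _ _ fun i => hC _ _)
  exact Finset.measurable_fun_prod _ fun i _ => (hF _).comp (measurable_pi_apply _)

theorem cum_map {Ω : Type*} [MeasurableSpace Ω] {P : Measure Ω} {ν : Measure Z} {j : ℕ}
    {g : Ω → Z} (hg : AEMeasurable g P) (hlaw : Measure.map g P = ν) {W : Z → ℝ}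
    (hW : Measurable W) : cum P j (fun ω => W (g ω)) = cum ν j W := by
  subst hlaw
  simp only [cum, jointCumulant]
  refine Finset.sum_congr rfl fun σ _ => ?_
  congr 1
  refine Finset.prod_congr rfl fun b _ => ?_
  exact (integral_map hg (Finset.measurable_fun_prod b fun _ _ => hW).aestronglyMeasurable).symm

end Probability

section Counting

variable {m k n : ℕ}

/-- The tuples `φ 0, …, φ m` that are linked along a spanning tree rooted at `0`, with parent map
`p` and overlaps `φ (i + 1) (a i) = φ (p i) (b i)`. -/
def IsLinkedAlong (p : Fin m → Fin (m + 1)) (a b : Fin m → Fin k)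
    (φ : Fin (m + 1) → Fin k → Fin n) : Prop :=
  ∃ r : Fin (m + 1) → ℕ, ∀ i, r (p i) < r i.succ ∧ φ i.succ (a i) = φ (p i) (b i)

theorem card_isLinkedAlong_le (hk : 1 ≤ k) (p : Fin m → Fin (m + 1)) (a b : Fin m → Fin k)
    (T : Finset (Fin (m + 1) → Fin k → Fin n)) (hT : ∀ φ ∈ T, IsLinkedAlong p a b φ) :
    T.card ≤ n ^ (1 + (k - 1) * (m + 1)) := by
  let g : (Fin (m + 1) → Fin k → Fin n) →
      (Fin k → Fin n) × (∀ i : Fin m, {c : Fin k // c ≠ a i} → Fin n) :=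
    fun φ => (φ 0, fun i c => φ i.succ c)
  have hinj : Set.InjOn g T := by
    intro φ hφ ψ hψ h
    obtain ⟨h0, hs⟩ := Prod.ext_iff.1 h
    obtain ⟨r, hr⟩ := hT φ hφ
    obtain ⟨r', hr'⟩ := hT ψ hψ
    have key : ∀ N, ∀ i, r i = N → φ i = ψ i := by
      intro N
      induction N using Nat.strong_induction_on with
      | _ N ih =>
        intro i hi
        refine Fin.cases (fun _ => h0) (fun i hi => ?_) i hi
        funext c
        by_cases hc : c = a i
        · rw [hc, (hr i).2, (hr' i).2, ih _ (hi ▸ (hr i).1) (p i) rfl]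
        · exact congrFun (congrFun hs i) ⟨c, hc⟩
    exact funext fun i => key _ i rfl
  have hcard := Finset.card_le_card_of_injOn g (fun φ _ => Finset.mem_univ (g φ)) hinj
  refine hcard.trans (le_of_eq ?_)
  rw [Finset.card_univ, Fintype.card_prod]
  simp only [Fintype.card_pi, Fintype.card_fin, ne_eq, Fintype.card_subtype_compl,
    Fintype.card_unique, Finset.prod_const, Finset.card_univ]
  rw [← pow_mul, ← pow_add]
  congr 1
  obtain ⟨l, rfl⟩ := Nat.exists_eq_add_of_le hk
  rw [Nat.add_sub_cancel_left]
  ring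

theorem card_linked_le (hk : 1 ≤ k) (T : Finset (Fin (m + 1) → Fin k → Fin n))
    (hT : ∀ φ ∈ T, ∃ p a b, IsLinkedAlong p a b φ) :
    T.card ≤ (m + 1) ^ m * (k ^ m * k ^ m) * n ^ (1 + (k - 1) * (m + 1)) := by
  classical
  have hsub : T ⊆ (Finset.univ : Finset ((Fin m → Fin (m + 1)) × (Fin m → Fin k)
      × (Fin m → Fin k))).biUnion
        fun q => T.filter fun φ => IsLinkedAlong q.1 q.2.1 q.2.2 φ := by
    intro φ hφ
    obtain ⟨p, a, b, h⟩ := hT φ hφ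
    exact Finset.mem_biUnion.2 ⟨(p, a, b), Finset.mem_univ _, Finset.mem_filter.2 ⟨hφ, h⟩⟩
  refine (Finset.card_le_card hsub).trans ((Finset.card_biUnion_le_card_mul _ _ _ fun q _ =>
    card_isLinkedAlong_le hk q.1 q.2.1 q.2.2 _ fun φ hφ => (Finset.mem_filter.1 hφ).2).trans ?_)
  simp

/-- A tuple that admits no splitting into two groups without overlaps is linked. -/
theorem exists_isLinkedAlong (φ : Fin (m + 1) → Fin k → Fin n)
    (h : ∀ A : Finset (Fin (m + 1)), 0 ∈ A →
      (∀ i ∈ A, ∀ l ∉ A, ∀ a b, φ i a ≠ φ l b) → A = Finset.univ) :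
    ∃ p a b, IsLinkedAlong p a b φ := by
  classical
  let G : SimpleGraph (Fin (m + 1)) := SimpleGraph.fromRel fun i l => ∃ a b, φ i a = φ l b
  have hreach : ∀ i, G.Reachable i 0 := by
    have hA := h (Finset.univ.filter fun i => G.Reachable i 0) (by simp) (by
      intro i hi l hl a b hab
      simp only [Finset.mem_filter, Finset.mem_univ, true_and] at hi hl
      have hne : l ≠ i := by rintro rfl; exact hl hi
      have hadj : G.Adj l i := (SimpleGraph.fromRel_adj _ _ _).2 ⟨hne, Or.inr ⟨a, b, hab⟩⟩
      exact hl (hadj.reachable.trans hi))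
    intro i
    have := hA ▸ Finset.mem_univ i
    exact (Finset.mem_filter.1 this).2
  have hstep : ∀ i : Fin m, ∃ l, ∃ a b, G.dist l 0 < G.dist i.succ 0 ∧ φ i.succ a = φ l b := by
    intro i
    obtain ⟨w, hw⟩ := (hreach i.succ).exists_walk_length_eq_dist
    obtain ⟨l, hadj, w', rfl⟩ := w.exists_eq_cons_of_ne (Fin.succ_ne_zero i)
    have hlt : G.dist l 0 < G.dist i.succ 0 := by
      rw [← hw, SimpleGraph.Walk.length_cons]
      exact Nat.lt_succ_of_le (SimpleGraph.dist_le w')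
    rcases ((SimpleGraph.fromRel_adj _ _ _).1 hadj).2 with ⟨a, b, hab⟩ | ⟨a, b, hab⟩
    · exact ⟨l, a, b, hlt, hab⟩
    · exact ⟨l, b, a, hlt, hab.symm⟩
  choose p a b hpab using hstep
  exact ⟨p, a, b, fun i => G.dist i 0, hpab⟩

theorem sq_le_two_pow_mul_factorial (l : ℕ) : (l + 2) ^ 2 ≤ 2 * 2 ^ l * (l + 2).factorial := by
  induction l with
  | zero => norm_num [Nat.factorial]
  | succ l ih =>
    rw [show l + 1 + 2 = (l + 2) + 1 from rfl, Nat.factorial_succ, pow_succ 2 l]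
    nlinarith [ih, Nat.zero_le (2 * 2 ^ l * (l + 2).factorial * l)]

theorem four_pow_mul_factorial_le (m : ℕ) :
    4 ^ m * m.factorial ≤ (m + 1).factorial * (m + 1).factorial := by
  induction m with
  | zero => simp
  | succ m ih =>
    rw [Nat.factorial_succ (m + 1), pow_succ, Nat.factorial_succ m] at *
    have h4 : 4 * (m + 1) ≤ (m + 2) * (m + 2) := by nlinarith
    calc 4 ^ m * 4 * ((m + 1) * m.factorial)
        = (4 * (m + 1)) * (4 ^ m * m.factorial) := by ring
      _ ≤ ((m + 2) * (m + 2)) * ((m + 1) * m.factorial * ((m + 1) * m.factorial)) :=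
          Nat.mul_le_mul h4 ih
      _ = _ := by ring

theorem two_pow_le_factorial_succ (m : ℕ) : 2 ^ m ≤ (m + 1).factorial := by
  induction m with
  | zero => simp
  | succ m ih =>
    rw [Nat.factorial_succ (m + 1), pow_succ, mul_comm]
    exact Nat.mul_le_mul (by omega) ih

theorem pow_mul_two_pow_mul_factorial_le (hk : 2 ≤ k) :
    (k ^ m * k ^ m) * (2 ^ m * m.factorial) ≤ (m + 1).factorial ^ k * k.factorial ^ m := by
  obtain ⟨l, rfl⟩ := Nat.exists_eq_add_of_le hk
  rw [add_comm 2 l]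
  calc ((l + 2) ^ m * (l + 2) ^ m) * (2 ^ m * m.factorial)
      = ((l + 2) ^ 2) ^ m * (2 ^ m * m.factorial) := by
        rw [← mul_pow, ← sq]
    _ ≤ (2 * 2 ^ l * (l + 2).factorial) ^ m * (2 ^ m * m.factorial) :=
        Nat.mul_le_mul_right _ (Nat.pow_le_pow_left (sq_le_two_pow_mul_factorial l) m)
    _ = (2 ^ m) ^ l * (4 ^ m * m.factorial) * (l + 2).factorial ^ m := by
        rw [show (4 : ℕ) = 2 * 2 from rfl, mul_pow, mul_pow, mul_pow, ← pow_mul, ← pow_mul,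
          mul_comm l m]
        ring
    _ ≤ (m + 1).factorial ^ l * ((m + 1).factorial * (m + 1).factorial)
          * (l + 2).factorial ^ m :=
        Nat.mul_le_mul_right _ (Nat.mul_le_mul
          (Nat.pow_le_pow_left (two_pow_le_factorial_succ m) l) (four_pow_mul_factorial_le m))
    _ = _ := by ring

end Counting

section GenU

variable {S M : Type*} {k n : ℕ}

/-- The value at `(a, b)` of the symmetric array whose entries above the diagonal are `y`, with
`e` on the diagonal. -/
def symArray (e : M) (y : {q : Fin n × Fin n // q.1 < q.2} → M) (a b : Fin n) : M :=
  if h : a < b then y ⟨(a, b), h⟩ else if h : b < a then y ⟨(b, a), h⟩ else e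

theorem measurable_symArray [MeasurableSpace M] (e : M) (a b : Fin n) :
    Measurable fun y => symArray e y a b := by
  unfold symArray
  by_cases h : a < b
  · simpa only [h, dif_pos] using measurable_pi_apply _
  by_cases h' : b < a
  · simpa only [h, h', dif_pos, dif_neg, not_false_eq_true] using measurable_pi_apply _
  · simpa only [h, h', dif_neg, not_false_eq_true] using measurable_const

/-- The summand of the generalized U-statistic indexed by `β`, as a function of the sample. -/
def genUTerm (f : (Fin k → S) → ({q : Fin k × Fin k // q.1 < q.2} → M) → ℝ) (e : M)
    (β : Fin k → Fin n) (z : (Fin n → S) × ({q : Fin n × Fin n // q.1 < q.2} → M)) : ℝ :=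
  f (fun i => z.1 (β i)) (fun q => symArray e z.2 (β q.1.1) (β q.1.2))

theorem measurable_genUTerm [MeasurableSpace S] [MeasurableSpace M]
    {f : (Fin k → S) → ({q : Fin k × Fin k // q.1 < q.2} → M) → ℝ}
    (hf : Measurable fun z : (Fin k → S) × ({q : Fin k × Fin k // q.1 < q.2} → M) => f z.1 z.2)
    (e : M) (β : Fin k → Fin n) : Measurable (genUTerm f e β) := by
  refine hf.comp (Measurable.prodMk ?_ ?_)
  · exact measurable_pi_lambda _ fun i => (measurable_pi_apply (β i)).comp measurable_fst
  · exact measurable_pi_lambda _ fun q => (measurable_symArray e _ _).comp measurable_snd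

theorem genUTerm_congr (f : (Fin k → S) → ({q : Fin k × Fin k // q.1 < q.2} → M) → ℝ) (e : M)
    (β : Fin k → Fin n) {s : Finset (Fin n)} (hs : ∀ i, β i ∈ s) {x x' : Fin n → S}
    {y y' : {q : Fin n × Fin n // q.1 < q.2} → M} (hx : ∀ i ∈ s, x i = x' i)
    (hy : ∀ q : {q : Fin n × Fin n // q.1 < q.2}, q.1.1 ∈ s → q.1.2 ∈ s → y q = y' q) :
    genUTerm f e β (x, y) = genUTerm f e β (x', y') := by
  unfold genUTerm
  congr 1
  · exact funext fun i => hx _ (hs i)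
  · funext q
    unfold symArray
    split_ifs
    · exact hy _ (hs _) (hs _)
    · exact hy _ (hs _) (hs _)
    · rfl

theorem genU_eq_sum_genUTerm {Ω : Type*}
    (f : (Fin k → S) → ({q : Fin k × Fin k // q.1 < q.2} → M) → ℝ) (e : M)
    (X : Fin n → Ω → S) (Y : Fin n → Fin n → Ω → M) (hYsym : ∀ a b, Y a b = Y b a) :
    genU f X Y = fun ω => ∑ β ∈ (Finset.univ : Finset (Fin k → Fin n)).filter Function.Injective,
      genUTerm f e β ((fun i => X i ω), fun q => Y q.1.1 q.1.2 ω) := by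
  funext ω
  refine Finset.sum_congr rfl fun β hβ => ?_
  unfold genUTerm
  congr 1
  funext q
  unfold symArray
  have hne : β q.1.1 ≠ β q.1.2 := fun h => q.2.ne ((Finset.mem_filter.1 hβ).2 h)
  rcases lt_or_gt_of_ne hne with h | h
  · rw [dif_pos h]
  · rw [dif_neg h.not_gt, dif_pos h, hYsym]

/-- Moments of the summands factorise over groups of index tuples without overlaps. -/
theorem integral_prod_genUTerm_eq_mul [MeasurableSpace S] [MeasurableSpace M]
    (μ : Measure S) [IsProbabilityMeasure μ] (Q : Measure M) [IsProbabilityMeasure Q]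
    {f : (Fin k → S) → ({q : Fin k × Fin k // q.1 < q.2} → M) → ℝ}
    (hf : Measurable fun z : (Fin k → S) × ({q : Fin k × Fin k // q.1 < q.2} → M) => f z.1 z.2)
    {C : ℝ} (hC : ∀ x y, |f x y| ≤ C) (e : M) {j : ℕ} (φ : Fin j → Fin k → Fin n)
    (A : Finset (Fin j)) (hA : ∀ i ∈ A, ∀ l ∉ A, ∀ a b, φ i a ≠ φ l b) (d : Finset (Fin j)) :
    ∫ z, ∏ i ∈ d, genUTerm f e (φ i) z ∂((Measure.pi fun _ => μ).prod (Measure.pi fun _ => Q))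
      = (∫ z, ∏ i ∈ d ∩ A, genUTerm f e (φ i) z
          ∂((Measure.pi fun _ => μ).prod (Measure.pi fun _ => Q)))
        * ∫ z, ∏ i ∈ d \ A, genUTerm f e (φ i) z
          ∂((Measure.pi fun _ => μ).prod (Measure.pi fun _ => Q)) := by
  classical
  let s : Finset (Fin n) := A.biUnion fun i => Finset.univ.image (φ i)
  let t : Finset (Fin n) := Aᶜ.biUnion fun i => Finset.univ.image (φ i)
  let pairs (u : Finset (Fin n)) : Finset {q : Fin n × Fin n // q.1 < q.2} :=
    Finset.univ.filter fun q => q.1.1 ∈ u ∧ q.1.2 ∈ u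
  have hst : Disjoint s t := by
    rw [Finset.disjoint_left]
    intro x hxs hxt
    simp only [s, t, Finset.mem_biUnion, Finset.mem_image, Finset.mem_univ, true_and,
      Finset.mem_compl] at hxs hxt
    obtain ⟨i, hi, a, rfl⟩ := hxs
    obtain ⟨l, hl, b, hab⟩ := hxt
    exact hA i hi l hl a b hab.symm
  have hpairs : Disjoint (pairs s) (pairs t) := by
    rw [Finset.disjoint_left]
    intro q hqs hqt
    exact Finset.disjoint_left.1 hst (Finset.mem_filter.1 hqs).2.1 (Finset.mem_filter.1 hqt).2.1
  have hmem : ∀ (B : Finset (Fin j)), ∀ i ∈ B, ∀ a,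
      φ i a ∈ B.biUnion fun i => Finset.univ.image (φ i) := fun B i hi a =>
    Finset.mem_biUnion.2 ⟨i, hi, Finset.mem_image_of_mem _ (Finset.mem_univ a)⟩
  have hmeas : ∀ B : Finset (Fin j), Measurable fun z => ∏ i ∈ B, genUTerm f e (φ i) z :=
    fun B => Finset.measurable_fun_prod B fun i _ => measurable_genUTerm hf e (φ i)
  have hbound : ∀ (B : Finset (Fin j)) z, |∏ i ∈ B, genUTerm f e (φ i) z| ≤ C ^ B.card :=
    fun B z => abs_prod_le B _ fun i => hC _ _
  rw [← integral_prod_mul_of_dependsOn μ Q hst hpairs (hmeas (d ∩ A)) (hmeas (d \ A))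
    (B := max (C ^ (d ∩ A).card) (C ^ (d \ A).card))
    (fun z => (hbound _ z).trans (le_max_left _ _))
    (fun z => (hbound _ z).trans (le_max_right _ _))]
  · simp_rw [Finset.prod_inter_mul_prod_sdiff]
  · intro x x' y y' hx hy
    refine Finset.prod_congr rfl fun i hi => genUTerm_congr f e (φ i)
      (hmem A i (Finset.mem_inter.1 hi).2) hx fun q h1 h2 => hy q ?_
    exact Finset.mem_filter.2 ⟨Finset.mem_univ _, h1, h2⟩
  · intro x x' y y' hx hy
    refine Finset.prod_congr rfl fun i hi => genUTerm_congr f e (φ i)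
      (hmem Aᶜ i (Finset.mem_compl.2 (Finset.mem_sdiff.1 hi).2)) hx fun q h1 h2 => hy q ?_
    exact Finset.mem_filter.2 ⟨Finset.mem_univ _, h1, h2⟩

end GenU

/-- Cumulant bound for generalized U-statistics: for all `j, n ≥ 1`,
`|κ_j(S_{n,k}(f))| ≤ n^{1+(k−1)j} ‖f‖_∞^j j^{j−1} (j!)^k (k!)^{j−1}`. -/
theorem cumulant_bound_genU {S M : Type*} [MeasurableSpace S] [MeasurableSpace M]
    {k : ℕ} (hk : 2 ≤ k) {n j : ℕ} (hn : 1 ≤ n) (hj : 1 ≤ j)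
    {Ω : Type*} [MeasurableSpace Ω] (P : Measure Ω) [IsProbabilityMeasure P]
    (μ : Measure S) [IsProbabilityMeasure μ] (hμ : ∀ x, μ {x} = 0)
    (Q : Measure M) [IsProbabilityMeasure Q]
    (X : Fin n → Ω → S) (Y : Fin n → Fin n → Ω → M)
    (hYsym : ∀ a b, Y a b = Y b a)
    (hlaw : Measure.map (fun ω => ((fun i => X i ω),
        (fun q : {q : Fin n × Fin n // q.1 < q.2} => Y q.1.1 q.1.2 ω))) P
      = (Measure.pi fun _ => μ).prod (Measure.pi fun _ => Q))
    (f : (Fin k → S) → ({q : Fin k × Fin k // q.1 < q.2} → M) → ℝ)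
    (hf : Measurable fun z : (Fin k → S) × ({q : Fin k × Fin k // q.1 < q.2} → M) =>
      f z.1 z.2)
    (C : ℝ) (hC : ∀ x y, |f x y| ≤ C) :
    |cum P j (genU f X Y)|
      ≤ (n : ℝ) ^ (1 + (k - 1) * j) * C ^ j * (j : ℝ) ^ (j - 1)
        * (j.factorial : ℝ) ^ k * (k.factorial : ℝ) ^ (j - 1) := by
  classical
  obtain ⟨x₀⟩ : Nonempty S := nonempty_of_isProbabilityMeasure μ
  obtain ⟨e⟩ : Nonempty M := nonempty_of_isProbabilityMeasure Q
  have hC0 : 0 ≤ C := (abs_nonneg _).trans (hC (fun _ => x₀) fun _ => e)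
  obtain ⟨m, rfl⟩ : ∃ m, j = m + 1 := ⟨j - 1, by omega⟩
  set T := (Finset.univ : Finset (Fin k → Fin n)).filter Function.Injective
  have hmeas : ∀ β : Fin k → Fin n, Measurable (genUTerm f e β) := measurable_genUTerm hf e
  have haem : AEMeasurable (fun ω => ((fun i => X i ω),
      (fun q : {q : Fin n × Fin n // q.1 < q.2} => Y q.1.1 q.1.2 ω))) P := by
    refine AEMeasurable.of_map_ne_zero ?_
    rw [hlaw]
    exact IsProbabilityMeasure.ne_zero _
  have hTmeas : Measurable fun z => ∑ β ∈ T, genUTerm f e β z :=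
    Finset.measurable_fun_sum T fun β _ => hmeas β
  rw [genU_eq_sum_genUTerm f e X Y hYsym, cum_map haem hlaw hTmeas,
    cum_sum _ T hmeas (fun β z => hC _ _)]
  set κ : (Fin (m + 1) → Fin k → Fin n) → ℝ := fun φ => momentCumulant (fun d =>
    ∫ z, ∏ i ∈ d, genUTerm f e (φ i) z ∂((Measure.pi fun _ => μ).prod (Measure.pi fun _ => Q)))
    Finset.univ
  set L := (Fintype.piFinset fun _ : Fin (m + 1) => T).filter
    fun φ => ∃ p a b, IsLinkedAlong p a b φ
  have hκbound : ∀ φ, |κ φ| ≤ 2 ^ m * (m.factorial : ℝ) * C ^ (m + 1) := by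
    intro φ
    have h := abs_momentCumulant_le (m := fun d => ∫ z, ∏ i ∈ d, genUTerm f e (φ i) z
      ∂((Measure.pi fun _ => μ).prod (Measure.pi fun _ => Q))) (by simp) hC0
      (fun d => abs_integral_prod_le _ d fun i z => hC _ _) Finset.univ Finset.univ_nonempty
    simpa using h
  have hκzero : ∀ φ ∈ Fintype.piFinset (fun _ : Fin (m + 1) => T), φ ∉ L → κ φ = 0 := by
    intro φ hφ hφL
    have hnot : ¬ ∃ p a b, IsLinkedAlong p a b φ := fun h => hφL (Finset.mem_filter.2 ⟨hφ, h⟩)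
    by_contra hne
    refine hnot (exists_isLinkedAlong φ fun A h0 hA => ?_)
    by_contra hAuniv
    refine hne (momentCumulant_eq_zero (by simp) A
      (integral_prod_genUTerm_eq_mul μ Q hf hC e φ A hA) Finset.univ ⟨0, by simpa using h0⟩ ?_)
    rwa [Finset.nonempty_iff_ne_empty, Ne, Finset.sdiff_eq_empty_iff_subset,
      Finset.univ_subset_iff]
  have hcard : L.card ≤ (m + 1) ^ m * (k ^ m * k ^ m) * n ^ (1 + (k - 1) * (m + 1)) :=
    card_linked_le (by omega) L fun φ hφ => (Finset.mem_filter.1 hφ).2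
  have hnum : ((k ^ m * k ^ m) * (2 ^ m * m.factorial) : ℝ)
      ≤ ((m + 1).factorial : ℝ) ^ k * (k.factorial : ℝ) ^ m := by
    exact_mod_cast pow_mul_two_pow_mul_factorial_le hk
  rw [← Finset.sum_subset (Finset.filter_subset _ _) hκzero, Nat.add_sub_cancel]
  calc |∑ φ ∈ L, κ φ|
      ≤ ∑ φ ∈ L, |κ φ| := Finset.abs_sum_le_sum_abs _ _
    _ ≤ L.card • (2 ^ m * (m.factorial : ℝ) * C ^ (m + 1)) :=
        Finset.sum_le_card_nsmul _ _ _ fun φ _ => hκbound φ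
    _ = (L.card : ℝ) * (2 ^ m * (m.factorial : ℝ) * C ^ (m + 1)) := nsmul_eq_mul _ _
    _ ≤ (((m + 1) ^ m * (k ^ m * k ^ m) * n ^ (1 + (k - 1) * (m + 1)) : ℕ) : ℝ)
          * (2 ^ m * (m.factorial : ℝ) * C ^ (m + 1)) := by
        gcongr
    _ = ((k ^ m * k ^ m) * (2 ^ m * m.factorial) : ℝ)
          * ((n : ℝ) ^ (1 + (k - 1) * (m + 1)) * C ^ (m + 1) * ((m + 1 : ℕ) : ℝ) ^ m) := by
        push_cast
        ring
    _ ≤ (((m + 1).factorial : ℝ) ^ k * (k.factorial : ℝ) ^ m)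
          * ((n : ℝ) ^ (1 + (k - 1) * (m + 1)) * C ^ (m + 1) * ((m + 1 : ℕ) : ℝ) ^ m) := by
        gcongr
    _ = _ := by ring
end

section
/- Suppose f satisfies Assumption 1 and set V := Var[Σ_{ℓ=1}^k f_{(ℓ)}(X_1)] > 0. Then for every n ≥ 2^{3k+1} ‖f‖_∞² k! / V, the variance of the generalized U-statistic satisfies κ_2(S_{n,k}(f)) = Var(S_{n,k}(f)) ≥ (V/2) · n!/(n−2k+1)!. -/
open MeasureTheory Finset ProbabilityTheory

section ProductMeasure

variable {ι κ S N : Type*} [Fintype ι] [Fintype κ] [MeasurableSpace S] [MeasurableSpace N]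

/-- Selecting distinct coordinates of an i.i.d. family gives an i.i.d. family. -/
theorem measurePreserving_pi_comp_injective (μ : Measure S) [IsProbabilityMeasure μ]
    {e : κ → ι} (he : Function.Injective e) :
    MeasurePreserving (fun x : ι → S => x ∘ e) (Measure.pi fun _ => μ)
      (Measure.pi fun _ => μ) := by
  have hm : Measurable (fun x : ι → S => x ∘ e) :=
    measurable_pi_lambda _ fun j => measurable_pi_apply (e j)
  refine ⟨hm, (Measure.pi_eq fun s hs => ?_).symm⟩
  have hpre : (fun x : ι → S => x ∘ e) ⁻¹' Set.pi Set.univ s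
      = Set.pi Set.univ (Function.extend e s fun _ => Set.univ) := by
    ext x
    simp only [Set.mem_preimage, Set.mem_univ_pi, Function.comp_apply]
    refine ⟨fun h i => ?_, fun h j => by simpa [he.extend_apply] using h (e j)⟩
    by_cases hi : ∃ j, e j = i
    · obtain ⟨j, rfl⟩ := hi
      simpa [he.extend_apply] using h j
    · simp [Function.extend_apply' _ _ _ hi]
  rw [Measure.map_apply hm (MeasurableSet.univ_pi hs), hpre, Measure.pi_pi]
  refine (Fintype.prod_of_injective e he _ _ (fun i hi => ?_) fun j => ?_).symm
  · rw [Function.extend_apply' _ _ _ (by simpa using hi), measure_univ]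
  · rw [he.extend_apply]

variable [DecidableEq ι]

/-- Resampling one coordinate of an i.i.d. family preserves its law. -/
theorem measurePreserving_update_pi (μ : Measure S) [IsProbabilityMeasure μ] (i : ι) :
    MeasurePreserving (fun p : S × (ι → S) => Function.update p.2 i p.1)
      (μ.prod (Measure.pi fun _ => μ)) (Measure.pi fun _ => μ) := by
  have hm : Measurable (fun p : S × (ι → S) => Function.update p.2 i p.1) := by
    refine measurable_pi_lambda _ fun j => ?_
    by_cases h : j = i
    · subst h
      simpa using measurable_fst
    · simp only [Function.update_of_ne h]
      exact (measurable_pi_apply j).comp measurable_snd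
  refine ⟨hm, (Measure.pi_eq fun s hs => ?_).symm⟩
  have hpre : (fun p : S × (ι → S) => Function.update p.2 i p.1) ⁻¹' Set.pi Set.univ s
      = s i ×ˢ Set.pi Set.univ (Function.update s i Set.univ) := by
    ext p
    simp only [Set.mem_preimage, Set.mem_univ_pi, Set.mem_prod]
    constructor
    · refine fun h => ⟨by simpa using h i, fun j => ?_⟩
      by_cases hj : j = i
      · subst hj; simp
      · simpa [hj] using h j
    · rintro ⟨h₁, h₂⟩ j
      by_cases hj : j = i
      · subst hj; simpa using h₁
      · simpa [hj] using h₂ j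
  rw [Measure.map_apply hm (MeasurableSet.univ_pi hs), hpre, Measure.prod_prod, Measure.pi_pi,
    ← Finset.mul_prod_erase Finset.univ (fun j => μ (s j)) (Finset.mem_univ i),
    ← Finset.mul_prod_erase Finset.univ _ (Finset.mem_univ i)]
  simp only [Function.update_self, measure_univ, one_mul]
  congr 1
  refine Finset.prod_congr rfl fun j hj => ?_
  rw [Function.update_of_ne (Finset.ne_of_mem_erase hj)]

theorem integrable_of_measurable_of_abs_le {ν : Measure N} [IsFiniteMeasure ν] {F : N → ℝ}
    (hF : Measurable F) {B : ℝ} (hB : ∀ x, |F x| ≤ B) : Integrable F ν :=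
  Integrable.of_bound hF.aestronglyMeasurable B (Filter.Eventually.of_forall hB)

theorem memLp_two_of_measurable_of_abs_le {ν : Measure N} [IsFiniteMeasure ν] {F : N → ℝ}
    (hF : Measurable F) {B : ℝ} (hB : ∀ x, |F x| ≤ B) : MemLp F 2 ν :=
  MemLp.of_bound hF.aestronglyMeasurable B (Filter.Eventually.of_forall hB)

theorem integral_mul_coord_eq (μ : Measure S) [IsProbabilityMeasure μ]
    (ρ : Measure N) [IsProbabilityMeasure ρ] {F : (ι → S) × N → ℝ} (hF : Measurable F)
    {B : ℝ} (hB : ∀ z, |F z| ≤ B) {h : S → ℝ} (hh : Measurable h) {D : ℝ}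
    (hD : ∀ x, |h x| ≤ D) (i : ι) :
    ∫ z, F z * h (z.1 i) ∂((Measure.pi fun _ => μ).prod ρ)
      = ∫ t, (∫ z, F (Function.update z.1 i t, z.2) ∂((Measure.pi fun _ => μ).prod ρ)) * h t
          ∂μ := by
  have hU : MeasurePreserving
      (fun p : S × ((ι → S) × N) => (Function.update p.2.1 i p.1, p.2.2))
      (μ.prod ((Measure.pi fun _ => μ).prod ρ)) ((Measure.pi fun _ => μ).prod ρ) :=
    ((measurePreserving_update_pi μ i).prod (MeasurePreserving.id ρ)).comp
      (measurePreserving_prodAssoc μ (Measure.pi fun _ => μ) ρ).symm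
  have hG : Measurable fun z : (ι → S) × N => F z * h (z.1 i) :=
    hF.mul (hh.comp ((measurable_pi_apply i).comp measurable_fst))
  have hGB : ∀ z : (ι → S) × N, |F z * h (z.1 i)| ≤ B * D := fun z => by
    rw [abs_mul]
    exact mul_le_mul (hB z) (hD _) (abs_nonneg _) ((abs_nonneg _).trans (hB z))
  rw [← hU.map_eq, integral_map hU.aemeasurable hG.aestronglyMeasurable, integral_prod, hU.map_eq]
  · simp only [Function.update_self, integral_mul_const]
  · exact integrable_of_measurable_of_abs_le (hG.comp hU.measurable) fun p => hGB _

theorem integral_mul_coord_eq_zero (μ : Measure S) [IsProbabilityMeasure μ]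
    (ρ : Measure N) [IsProbabilityMeasure ρ] {F : (ι → S) × N → ℝ} (hF : Measurable F)
    {B : ℝ} (hB : ∀ z, |F z| ≤ B) {h : S → ℝ} (hh : Measurable h) {D : ℝ}
    (hD : ∀ x, |h x| ≤ D) (h0 : ∫ x, h x ∂μ = 0) {i : ι}
    (hi : ∀ z t, F (Function.update z.1 i t, z.2) = F z) :
    ∫ z, F z * h (z.1 i) ∂((Measure.pi fun _ => μ).prod ρ) = 0 := by
  rw [integral_mul_coord_eq μ ρ hF hB hh hD]
  simp only [hi, integral_const_mul, h0, mul_zero]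

/-- The Cauchy–Schwarz inequality against a sum of centred functions of single coordinates. -/
theorem sq_sum_integral_mul_coord_le (μ : Measure S) [IsProbabilityMeasure μ]
    (ρ : Measure N) [IsProbabilityMeasure ρ] {T : (ι → S) × N → ℝ} (hT : Measurable T)
    {B : ℝ} (hB : ∀ z, |T z| ≤ B) {h : S → ℝ} (hh : Measurable h) {D : ℝ}
    (hD : ∀ x, |h x| ≤ D) (h0 : ∫ x, h x ∂μ = 0) :
    (∑ i, ∫ z, T z * h (z.1 i) ∂((Measure.pi fun _ => μ).prod ρ)) ^ 2
      ≤ variance T ((Measure.pi fun _ => μ).prod ρ)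
        * (Fintype.card ι * ∫ x, h x * h x ∂μ) := by
  set ν := (Measure.pi fun _ : ι => μ).prod ρ with hν
  have hhi : ∀ i, Measurable fun z : (ι → S) × N => h (z.1 i) := fun i =>
    hh.comp ((measurable_pi_apply i).comp measurable_fst)
  have hmean : ∀ i, ∫ z, h (z.1 i) ∂ν = 0 := fun i => by
    have := integral_mul_coord_eq_zero μ ρ (F := fun _ : (ι → S) × N => (1 : ℝ)) (i := i)
      measurable_const (B := 1) (by simp) hh hD h0 (by simp)
    simpa using this
  have hTL : MemLp T 2 ν := memLp_two_of_measurable_of_abs_le hT hB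
  have hWi : ∀ i, MemLp (fun z : (ι → S) × N => h (z.1 i)) 2 ν := fun i =>
    memLp_two_of_measurable_of_abs_le (hhi i) fun z => hD _
  have hcov : ∀ G : (ι → S) × N → ℝ, MemLp G 2 ν → ∀ i,
      covariance G (fun z => h (z.1 i)) ν = ∫ z, G z * h (z.1 i) ∂ν := fun G hG i => by
    rw [covariance_eq_sub hG (hWi i), hmean i]
    simp
  have hW : MemLp (fun z : (ι → S) × N => ∑ i, h (z.1 i)) 2 ν :=
    memLp_finsetSum _ fun i _ => hWi i
  have hself : ∀ i j, ∫ z, h (z.1 j) * h (z.1 i) ∂ν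
      = if j = i then ∫ x, h x * h x ∂μ else 0 := fun i j => by
    split_ifs with hji
    · subst hji
      rw [integral_mul_coord_eq μ ρ (F := fun z => h (z.1 j)) (hhi j) (fun z => hD _) hh hD j]
      simp
    · exact integral_mul_coord_eq_zero μ ρ (F := fun z => h (z.1 j)) (hhi j) (fun z => hD _) hh hD
        h0 fun z t => by simp [hji]
  have hvarW : variance (fun z : (ι → S) × N => ∑ i, h (z.1 i)) ν
      = Fintype.card ι * ∫ x, h x * h x ∂μ := by
    rw [← covariance_self hW.aemeasurable, covariance_fun_sum_fun_sum hWi hWi]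
    simp [hcov _ (hWi _), hself]
  have hcovT : covariance T (fun z => ∑ i, h (z.1 i)) ν = ∑ i, ∫ z, T z * h (z.1 i) ∂ν := by
    rw [covariance_fun_sum_right hWi hTL]
    simp only [hcov T hTL]
  have key : ∀ c : ℝ, 0 ≤ (Fintype.card ι * ∫ x, h x * h x ∂μ) * (c * c)
      + (-2 * ∑ i, ∫ z, T z * h (z.1 i) ∂ν) * c + variance T ν := fun c => by
    have := variance_nonneg (fun z => T z - c * ∑ i, h (z.1 i)) ν
    rw [variance_fun_sub hTL (hW.const_mul c), covariance_const_mul_right, hcovT,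
      variance_const_mul, hvarW] at this
    linarith
  have := discrim_le_zero key
  rw [discrim] at this
  linarith

end ProductMeasure

/-- The position of the unordered pair `{β q₁, β q₂}` among the increasing pairs. -/
def sortedPair {k n : ℕ} (β : Fin k → Fin n) (hβ : Function.Injective β)
    (q : {q : Fin k × Fin k // q.1 < q.2}) : {q : Fin n × Fin n // q.1 < q.2} :=
  if h : β q.1.1 < β q.1.2 then ⟨(β q.1.1, β q.1.2), h⟩
  else ⟨(β q.1.2, β q.1.1), lt_of_le_of_ne (not_lt.1 h) (hβ.ne q.2.ne')⟩

theorem sortedPair_injective {k n : ℕ} (β : Fin k → Fin n) (hβ : Function.Injective β) :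
    Function.Injective (sortedPair β hβ) := by
  rintro ⟨⟨a, b⟩, hab⟩ ⟨⟨c, d⟩, hcd⟩ h
  unfold sortedPair at h
  simp only at h hab hcd
  split_ifs at h <;> simp only [Subtype.mk.injEq, Prod.mk.injEq, hβ.eq_iff] at h ⊢ <;> omega

theorem apply_sortedPair {k n : ℕ} {M : Type*} (β : Fin k → Fin n) (hβ : Function.Injective β)
    (Y : Fin n → Fin n → M) (hY : ∀ a b, Y a b = Y b a)
    (q : {q : Fin k × Fin k // q.1 < q.2}) :
    Y (sortedPair β hβ q).1.1 (sortedPair β hβ q).1.2 = Y (β q.1.1) (β q.1.2) := by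
  unfold sortedPair
  split_ifs
  · rfl
  · exact hY _ _

section Projection

variable {S M : Type*} [MeasurableSpace S] [MeasurableSpace M] {k n : ℕ}
  {f : (Fin k → S) → ({q : Fin k × Fin k // q.1 < q.2} → M) → ℝ}

theorem measurable_fProj (μ : Measure S) [IsProbabilityMeasure μ] (Q : Measure M)
    [IsProbabilityMeasure Q]
    (hf : Measurable fun z : (Fin k → S) × ({q : Fin k × Fin k // q.1 < q.2} → M) =>
      f z.1 z.2) (ℓ : Fin k) : Measurable (fProj f μ Q ℓ) := by
  refine StronglyMeasurable.measurable (StronglyMeasurable.integral_prod_right'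
    (f := fun p : S × ((Fin k → S) × ({q : Fin k × Fin k // q.1 < q.2} → M)) =>
      f (Function.update p.2.1 ℓ p.1) p.2.2) (Measurable.stronglyMeasurable ?_))
  have hu : Measurable fun p : S × ((Fin k → S) × ({q : Fin k × Fin k // q.1 < q.2} → M)) =>
      Function.update p.2.1 ℓ p.1 :=
    (measurePreserving_update_pi μ ℓ).measurable.comp
      (measurable_fst.prodMk (measurable_fst.comp measurable_snd))
  exact hf.comp (hu.prodMk (measurable_snd.comp measurable_snd))

theorem abs_fProj_le (μ : Measure S) [IsProbabilityMeasure μ] (Q : Measure M)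
    [IsProbabilityMeasure Q] {C : ℝ} (hC : ∀ x y, |f x y| ≤ C) (ℓ : Fin k) (x : S) :
    |fProj f μ Q ℓ x| ≤ C := by
  have := norm_integral_le_of_norm_le_const
    (μ := (Measure.pi fun _ : Fin k => μ).prod
      (Measure.pi fun _ : {q : Fin k × Fin k // q.1 < q.2} => Q))
    (f := fun z => f (Function.update z.1 ℓ x) z.2) (Filter.Eventually.of_forall fun z => hC _ _)
  simpa [fProj] using this

/-- Integrating a summand of the U-statistic against functions of single coordinates. -/
theorem sum_integral_summand_mul_coord (μ : Measure S) [IsProbabilityMeasure μ] (Q : Measure M)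
    [IsProbabilityMeasure Q]
    (hf : Measurable fun z : (Fin k → S) × ({q : Fin k × Fin k // q.1 < q.2} → M) =>
      f z.1 z.2)
    {C : ℝ} (hC : ∀ x y, |f x y| ≤ C) {h : S → ℝ} (hh : Measurable h) {D : ℝ}
    (hD : ∀ x, |h x| ≤ D) (h0 : ∫ x, h x ∂μ = 0)
    {β : Fin k → Fin n} (hβ : Function.Injective β)
    {e : {q : Fin k × Fin k // q.1 < q.2} → {q : Fin n × Fin n // q.1 < q.2}}
    (he : Function.Injective e) :
    ∑ i, ∫ z : (Fin n → S) × ({q : Fin n × Fin n // q.1 < q.2} → M),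
        f (z.1 ∘ β) (z.2 ∘ e) * h (z.1 i)
        ∂((Measure.pi fun _ => μ).prod (Measure.pi fun _ => Q))
      = ∫ x, (∑ ℓ, fProj f μ Q ℓ x) * h x ∂μ := by
  have hmp := (measurePreserving_pi_comp_injective μ hβ).prod
    (measurePreserving_pi_comp_injective Q he)
  have hF := hf.comp hmp.measurable
  simp only [Finset.sum_mul]
  rw [integral_finsetSum]
  · refine (Fintype.sum_of_injective β hβ _ _ (fun i hi => ?_) fun ℓ => ?_).symm
    · refine integral_mul_coord_eq_zero μ _ hF (fun z => hC _ _) hh hD h0 fun z t => ?_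
      have : Function.update z.1 i t ∘ β = z.1 ∘ β :=
        Function.update_comp_eq_of_notMem_range _ _ hi
      simp [this]
    · refine Eq.trans ?_ (integral_mul_coord_eq μ _ hF (fun z => hC _ _) hh hD (β ℓ)).symm
      refine integral_congr_ae (Filter.Eventually.of_forall fun t => ?_)
      have hu : Measurable fun z : (Fin k → S) × ({q : Fin k × Fin k // q.1 < q.2} → M) =>
          f (Function.update z.1 ℓ t) z.2 :=
        hf.comp ((((measurePreserving_update_pi μ ℓ).measurable.comp
          (measurable_const.prodMk measurable_fst))).prodMk measurable_snd)
      simp only [fProj, Function.comp_apply, Prod.map_fst, Prod.map_snd,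
        Function.update_comp_eq_of_injective _ hβ]
      congr 1
      rw [← hmp.map_eq, integral_map hmp.aemeasurable hu.aestronglyMeasurable]
      rfl
  · intro ℓ _
    refine integrable_of_measurable_of_abs_le ((measurable_fProj μ Q hf ℓ).mul hh) (B := C * D)
      fun x => ?_
    rw [abs_mul]
    have hp := abs_fProj_le μ Q hC ℓ x
    exact mul_le_mul hp (hD x) (abs_nonneg _) ((abs_nonneg _).trans hp)

end Projection

theorem card_filter_injective (k n : ℕ) :
    #{β : Fin k → Fin n | Function.Injective β} = n.descFactorial k := by
  classical
  rw [← Fintype.card_subtype, Fintype.card_congr (Equiv.subtypeInjectiveEquivEmbedding _ _),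
    Fintype.card_embedding_eq, Fintype.card_fin, Fintype.card_fin]

theorem mul_descFactorial_le_sq {k : ℕ} (hk : 1 ≤ k) (n : ℕ) :
    n * n.descFactorial (2 * k - 1) ≤ n.descFactorial k ^ 2 := by
  obtain ⟨m, rfl⟩ := Nat.exists_eq_add_of_le' hk
  cases n with
  | zero => simp
  | succ n =>
    rw [← Nat.descFactorial_mul_descFactorial (show m + 1 ≤ 2 * (m + 1) - 1 by omega),
      show 2 * (m + 1) - 1 - (m + 1) = m by omega, sq, ← mul_assoc,
      Nat.succ_descFactorial_succ n m]
    exact Nat.mul_le_mul_right _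
      (Nat.mul_le_mul_left _ (Nat.descFactorial_le _ (by omega)))

/-- Variance lower bound for generalized U-statistics: under Assumption 1 with
`V = Var[Σ_{ℓ=1}^k f_{(ℓ)}(X_1)] > 0`, for every `n ≥ 2^{3k+1}‖f‖_∞² k!/V`,
`Var(S_{n,k}(f)) ≥ (V/2) · n!/(n−2k+1)!` (the latter quotient of factorials being the
falling factorial `n(n−1)⋯(n−2k+2)`). -/
theorem variance_lower_bound_genU {S M : Type*} [MeasurableSpace S] [MeasurableSpace M]
    {k : ℕ} (hk : 2 ≤ k) {n : ℕ}
    {Ω : Type*} [MeasurableSpace Ω] (P : Measure Ω) [IsProbabilityMeasure P]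
    (μ : Measure S) [IsProbabilityMeasure μ] (hμ : ∀ x, μ {x} = 0)
    (Q : Measure M) [IsProbabilityMeasure Q]
    (X : Fin n → Ω → S) (Y : Fin n → Fin n → Ω → M)
    (hYsym : ∀ a b, Y a b = Y b a)
    (hlaw : Measure.map (fun ω => ((fun i => X i ω),
        (fun q : {q : Fin n × Fin n // q.1 < q.2} => Y q.1.1 q.1.2 ω))) P
      = (Measure.pi fun _ => μ).prod (Measure.pi fun _ => Q))
    (f : (Fin k → S) → ({q : Fin k × Fin k // q.1 < q.2} → M) → ℝ)
    (hf : Measurable fun z : (Fin k → S) × ({q : Fin k × Fin k // q.1 < q.2} → M) =>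
      f z.1 z.2)
    (C : ℝ) (hC : ∀ x y, |f x y| ≤ C)
    (V : ℝ) (hV : V = variance (fun x => ∑ ℓ : Fin k, fProj f μ Q ℓ x) μ) (hVpos : 0 < V)
    (hn : 2 ^ (3 * k + 1) * C ^ 2 * (k.factorial : ℝ) / V ≤ (n : ℝ)) :
    (V / 2) * (n.descFactorial (2 * k - 1) : ℝ) ≤ variance (genU f X Y) P := by
  rcases Nat.eq_zero_or_pos n with rfl | hnpos
  · obtain ⟨m, hm⟩ : ∃ m, 2 * k - 1 = m + 1 := ⟨2 * k - 2, by omega⟩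
    simp [hm, variance_nonneg]
  set ν := (Measure.pi fun _ : Fin n => μ).prod
    (Measure.pi fun _ : {q : Fin n × Fin n // q.1 < q.2} => Q) with hν
  set φ := fun ω => ((fun i => X i ω),
    (fun q : {q : Fin n × Fin n // q.1 < q.2} => Y q.1.1 q.1.2 ω)) with hφ
  have hφm : AEMeasurable φ P := by
    by_contra hcon
    rw [Measure.map_of_not_aemeasurable hcon] at hlaw
    exact IsProbabilityMeasure.ne_zero ν hlaw.symm
  let F : (Fin k → Fin n) → (Fin n → S) × ({q : Fin n × Fin n // q.1 < q.2} → M) → ℝ :=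
    fun β z => if hβ : Function.Injective β then f (z.1 ∘ β) (z.2 ∘ sortedPair β hβ) else 0
  have hFβ : ∀ β (hβ : Function.Injective β),
      F β = fun z => f (z.1 ∘ β) (z.2 ∘ sortedPair β hβ) := fun β hβ => by
    funext z
    simp only [F, dif_pos hβ]
  let I := (Finset.univ : Finset (Fin k → Fin n)).filter Function.Injective
  let T := fun z => ∑ β ∈ I, F β z
  have hgenU : genU f X Y = T ∘ φ := by
    funext ω
    refine Finset.sum_congr rfl fun β hβ => ?_
    have hinj : Function.Injective β := (Finset.mem_filter.1 hβ).2
    rw [hFβ β hinj]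
    refine congrArg (f _) (funext fun q => ?_)
    exact (apply_sortedPair β hinj (fun a b => Y a b ω) (fun a b => by rw [hYsym]) q).symm
  have hFm : ∀ β ∈ I, Measurable (F β) := fun β hβ => by
    have hinj : Function.Injective β := (Finset.mem_filter.1 hβ).2
    rw [hFβ β hinj]
    exact hf.comp ((measurePreserving_pi_comp_injective μ hinj).prod
      (measurePreserving_pi_comp_injective Q (sortedPair_injective β hinj))).measurable
  have hFC : ∀ β ∈ I, ∀ z, |F β z| ≤ C := fun β hβ z => by
    rw [hFβ β (Finset.mem_filter.1 hβ).2]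
    exact hC _ _
  have hTm : Measurable T := Finset.measurable_sum _ hFm
  have hTB : ∀ z, |T z| ≤ #I * C := fun z => by
    refine (Finset.abs_sum_le_sum_abs _ _).trans ?_
    simpa using Finset.sum_le_sum fun β hβ => hFC β hβ z
  set g := fun x => ∑ ℓ : Fin k, fProj f μ Q ℓ x with hg
  have hgm : Measurable g := Finset.measurable_sum _ fun ℓ _ => measurable_fProj μ Q hf ℓ
  have hgB : ∀ x, |g x| ≤ k * C := fun x => by
    refine (Finset.abs_sum_le_sum_abs _ _).trans ?_
    simpa using Finset.sum_le_sum fun ℓ (_ : ℓ ∈ Finset.univ) => abs_fProj_le μ Q hC ℓ x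
  have hgi : Integrable g μ := integrable_of_measurable_of_abs_le hgm hgB
  set m := ∫ x, g x ∂μ with hm
  let h := fun x => g x - m
  have hhm : Measurable h := hgm.sub_const m
  have hhB : ∀ x, |h x| ≤ k * C + |m| := fun x =>
    (abs_sub _ _).trans (add_le_add_left (hgB x) _)
  have h0 : ∫ x, h x ∂μ = 0 := by
    simp only [h]
    rw [integral_sub hgi (integrable_const _)]
    simp [hm]
  have hhi : Integrable h μ := integrable_of_measurable_of_abs_le hhm hhB
  have hhV : ∫ x, h x * h x ∂μ = V := by
    rw [hV, variance_eq_integral hgm.aemeasurable]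
    exact integral_congr_ae (Filter.Eventually.of_forall fun x => (sq (h x)).symm)
  have hgh : ∫ x, g x * h x ∂μ = V := by
    have hmul : Integrable (fun x => h x * h x) μ :=
      (memLp_two_of_measurable_of_abs_le hhm hhB).integrable_mul
        (memLp_two_of_measurable_of_abs_le hhm hhB)
    calc ∫ x, g x * h x ∂μ = ∫ x, (h x * h x + m * h x) ∂μ := by
          refine integral_congr_ae (Filter.Eventually.of_forall fun x => ?_)
          simp only [h]
          ring
      _ = V := by rw [integral_add hmul (hhi.const_mul m), integral_const_mul, h0, hhV]; simp
  have hA : ∑ i, ∫ z, T z * h (z.1 i) ∂ν = n.descFactorial k * V := by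
    have hint : ∀ i, ∫ z, T z * h (z.1 i) ∂ν = ∑ β ∈ I, ∫ z, F β z * h (z.1 i) ∂ν := fun i => by
      simp only [T, Finset.sum_mul]
      refine integral_finsetSum _ fun β hβ => ?_
      exact (memLp_two_of_measurable_of_abs_le (hFm β hβ) (hFC β hβ)).integrable_mul
        (memLp_two_of_measurable_of_abs_le
          (hhm.comp ((measurable_pi_apply i).comp measurable_fst)) fun z => hhB _)
    simp only [hint]
    rw [Finset.sum_comm, Finset.sum_congr rfl fun β hβ => ?_, Finset.sum_const,
      card_filter_injective, nsmul_eq_mul]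
    have hinj : Function.Injective β := (Finset.mem_filter.1 hβ).2
    rw [hFβ β hinj, ← hgh]
    exact sum_integral_summand_mul_coord μ Q hf hC hhm hhB h0 hinj (sortedPair_injective β hinj)
  have hCS := sq_sum_integral_mul_coord_le μ
    (Measure.pi fun _ : {q : Fin n × Fin n // q.1 < q.2} => Q) hTm hTB hhm hhB h0
  rw [← hν, hA, hhV, Fintype.card_fin] at hCS
  have hvar : variance (genU f X Y) P = variance T ν := by
    rw [hgenU, ← hlaw, variance_map hTm.aemeasurable hφm]
  rw [hvar]
  have hcount : (n : ℝ) * n.descFactorial (2 * k - 1) ≤ (n.descFactorial k : ℝ) ^ 2 := by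
    exact_mod_cast mul_descFactorial_le_sq (by omega : 1 ≤ k) n
  have hnV : 0 < (n : ℝ) * V := mul_pos (by exact_mod_cast hnpos) hVpos
  have hfull : V * n.descFactorial (2 * k - 1) ≤ variance T ν := by
    refine le_of_mul_le_mul_right ?_ hnV
    calc V * n.descFactorial (2 * k - 1) * (n * V)
        = V ^ 2 * (n * n.descFactorial (2 * k - 1)) := by ring
      _ ≤ V ^ 2 * (n.descFactorial k : ℝ) ^ 2 := by gcongr
      _ = (n.descFactorial k * V) ^ 2 := by ring
      _ ≤ variance T ν * (n * V) := hCS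
  refine le_trans (mul_le_mul_of_nonneg_right ?_ (Nat.cast_nonneg _)) hfull
  linarith
end
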